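/- arXiv:2410.00573 — 4 statements merged into one kernel-verified Lean document; each statement's English description precedes it below -/
import Mathlib

section
/- Under the clipped stochastic subgradient setup with the epoch-wise finite-horizon parameter schedule for a fixed horizon k ≥ 2, the last iterate satisfies E[f(x_k)] − f* ≤ (1/k^{(p−1)/p}) [ (6/5) ‖x_1 − x*‖²/γ + (53/10) · (2^{p−1}/(2^{p−1} − 1)) · ( ‖x_1 − x*‖ v_p + γ (v_p + √(w_p))² ) ]. -/
open MeasureTheory Real
open scoped RealInnerProductSpace

/-- A nearest point of a convex set contracts distances to the points of that set. -/
lemma norm_sub_sq_le_of_nearest_point {H : Type*} [NormedAddCommGroup H] [InnerProductSpace ℝ H]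
    {X : Set H} (hX : Convex ℝ X) {v w y : H} (hv : v ∈ X) (hy : y ∈ X)
    (hmin : ∀ t ∈ X, ‖v - w‖ ≤ ‖t - w‖) : ‖v - y‖ ^ 2 ≤ ‖w - y‖ ^ 2 := by
  have hinf : ‖w - v‖ = ⨅ t : X, ‖w - t‖ := by
    have : Nonempty X := ⟨⟨v, hv⟩⟩
    refine le_antisymm (le_ciInf fun t => ?_) (ciInf_le ⟨0, ?_⟩ (⟨v, hv⟩ : X))
    · rw [norm_sub_rev w v, norm_sub_rev w]
      exact hmin t t.2
    · rintro _ ⟨t, rfl⟩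
      exact norm_nonneg _
  have hle := (norm_eq_iInf_iff_real_inner_le_zero hX hv).1 hinf y hy
  have hsplit : w - y = (w - v) - (y - v) := by abel
  have hexp := norm_sub_sq_real (w - v) (y - v)
  rw [← hsplit, norm_sub_rev y v] at hexp
  nlinarith [sq_nonneg ‖w - v‖]

/-- Expected one-step progress of a projected stochastic subgradient step with a biased,
bounded subgradient estimate, relative to a reference point known before the step. -/
lemma expected_projected_subgradient_step {H : Type*} [NormedAddCommGroup H]
    [InnerProductSpace ℝ H] [CompleteSpace H]
    {Ω : Type*} [mΩ : MeasurableSpace Ω] (μ : Measure Ω) [IsProbabilityMeasure μ]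
    {m : MeasurableSpace Ω} (hm : m ≤ mΩ) {X : Set H} (hX : Convex ℝ X)
    {f : H → ℝ} {x x' z u ut : Ω → H} {γ b s C : ℝ} (hγ : 0 < γ) (hb : 0 ≤ b)
    (hx : StronglyMeasurable[m] x) (hz : StronglyMeasurable[m] z)
    (hx2 : MemLp x 2 μ) (hz2 : MemLp z 2 μ) (hx'2 : MemLp x' 2 μ)
    (hfx : Integrable (fun ω => f (x ω)) μ) (hfz : Integrable (fun ω => f (z ω)) μ)
    (hzX : ∀ ω, z ω ∈ X)
    (husub : ∀ᵐ ω ∂μ, ∀ y : H, f (x ω) + ⟪u ω, y - x ω⟫ ≤ f y)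
    (hut : AEStronglyMeasurable[mΩ] ut μ) (hutbdd : ∀ᵐ ω ∂μ, ‖ut ω‖ ≤ C)
    (hbias : ∀ᵐ ω ∂μ, ‖(μ[ut | m]) ω - u ω‖ ≤ b)
    (hmom : ∀ᵐ ω ∂μ, (μ[(fun ω' => ‖ut ω'‖ ^ 2) | m]) ω ≤ s)
    (hproj : ∀ ω, x' ω ∈ X ∧
      ∀ y ∈ X, ‖x' ω - (x ω - γ • ut ω)‖ ≤ ‖y - (x ω - γ • ut ω)‖) :
    2 * γ * ((∫ ω, f (x ω) ∂μ) - ∫ ω, f (z ω) ∂μ) + ∫ ω, ‖x' ω - z ω‖ ^ 2 ∂μ ≤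
      (∫ ω, ‖x ω - z ω‖ ^ 2 ∂μ) + 2 * (γ * b) * √(∫ ω, ‖x ω - z ω‖ ^ 2 ∂μ) + γ ^ 2 * s := by
  have hut2 : MemLp ut 2 μ := MemLp.of_bound hut C hutbdd
  have hd2 : MemLp (fun ω => x ω - z ω) 2 μ := hx2.sub hz2
  have hdi : Integrable (fun ω => ‖x ω - z ω‖ ^ 2) μ := hd2.integrable_norm_pow (by norm_num)
  have hd'i : Integrable (fun ω => ‖x' ω - z ω‖ ^ 2) μ :=
    (hx'2.sub hz2).integrable_norm_pow (by norm_num)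
  have hd1 : Integrable (fun ω => ‖x ω - z ω‖) μ := (hd2.integrable (by norm_num)).norm
  have huti : Integrable (fun ω => ‖ut ω‖ ^ 2) μ := hut2.integrable_norm_pow (by norm_num)
  have hini : Integrable (fun ω => ⟪ut ω, x ω - z ω⟫) μ := by
    refine (hdi.add huti).mono' (hut.inner hd2.1) (.of_forall fun ω => ?_)
    have := norm_inner_le_norm (𝕜 := ℝ) (ut ω) (x ω - z ω)
    simp only [Pi.add_apply]
    nlinarith [sq_nonneg (‖ut ω‖ - ‖x ω - z ω‖), sq_nonneg (‖ut ω‖), sq_nonneg (‖x ω - z ω‖)]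
  have hfd : Integrable (fun ω => f (x ω) - f (z ω)) μ := hfx.sub hfz
  have hstepi : Integrable (fun ω => ‖x ω - z ω‖ ^ 2 - 2 * γ * ⟪ut ω, x ω - z ω⟫) μ :=
    hdi.sub (hini.const_mul _)
  have hpull : μ[fun ω => ⟪ut ω, x ω - z ω⟫ | m] =ᵐ[μ] fun ω => ⟪(μ[ut | m]) ω, x ω - z ω⟫ :=
    condExp_bilin_of_stronglyMeasurable_right (innerSL ℝ) (hx.sub hz) hini
      (hut2.integrable (by norm_num))
  have hinner : (∫ ω, f (x ω) ∂μ) - (∫ ω, f (z ω) ∂μ) - b * ∫ ω, ‖x ω - z ω‖ ∂μ ≤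
      ∫ ω, ⟪ut ω, x ω - z ω⟫ ∂μ := by
    rw [← integral_condExp hm (f := fun ω => ⟪ut ω, x ω - z ω⟫), ← integral_sub hfx hfz,
      ← integral_const_mul, ← integral_sub hfd (hd1.const_mul b)]
    refine integral_mono_ae (hfd.sub (hd1.const_mul b)) integrable_condExp ?_
    filter_upwards [hpull, husub, hbias] with ω hω hsub hbi
    rw [hω]
    have h1 := hsub (z ω)
    have h2 : ⟪u ω, z ω - x ω⟫ = - ⟪u ω, x ω - z ω⟫ := by
      rw [← inner_neg_right, neg_sub]
    have h3 : ⟪(μ[ut | m]) ω, x ω - z ω⟫ =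
        ⟪u ω, x ω - z ω⟫ + ⟪(μ[ut | m]) ω - u ω, x ω - z ω⟫ := by
      rw [inner_sub_left]; ring
    have h4 := (abs_le.1 (abs_real_inner_le_norm ((μ[ut | m]) ω - u ω) (x ω - z ω))).1
    have h5 := mul_le_mul_of_nonneg_right hbi (norm_nonneg (x ω - z ω))
    linarith
  have hsq : ∫ ω, ‖ut ω‖ ^ 2 ∂μ ≤ s := by
    rw [← integral_condExp hm]
    calc _ ≤ ∫ _, s ∂μ := integral_mono_ae integrable_condExp (integrable_const s) hmom
      _ = s := by simp
  have hjensen : ∫ ω, ‖x ω - z ω‖ ∂μ ≤ √(∫ ω, ‖x ω - z ω‖ ^ 2 ∂μ) := by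
    refine Real.le_sqrt_of_sq_le ?_
    have := (even_two.convexOn_pow (𝕜 := ℝ)).map_integral_le (μ := μ)
      (f := fun ω => ‖x ω - z ω‖) (by fun_prop) isClosed_univ (by simp) hd1 hdi
    simpa using this
  have hstep : ∫ ω, ‖x' ω - z ω‖ ^ 2 ∂μ ≤ (∫ ω, ‖x ω - z ω‖ ^ 2 ∂μ)
      - 2 * γ * (∫ ω, ⟪ut ω, x ω - z ω⟫ ∂μ) + γ ^ 2 * ∫ ω, ‖ut ω‖ ^ 2 ∂μ := by
    rw [← integral_const_mul, ← integral_const_mul, ← integral_sub hdi (hini.const_mul _),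
      ← integral_add hstepi (huti.const_mul _)]
    refine integral_mono hd'i (hstepi.add (huti.const_mul _)) fun ω => ?_
    have h1 := norm_sub_sq_le_of_nearest_point hX (hproj ω).1 (hzX ω) (hproj ω).2
    have h2 : x ω - γ • ut ω - z ω = (x ω - z ω) - γ • ut ω := by abel
    rw [h2, norm_sub_sq_real (x ω - z ω), inner_smul_right, norm_smul, mul_pow, Real.norm_eq_abs, sq_abs,
      real_inner_comm] at h1
    beta_reduce
    linarith
  have h1 := mul_le_mul_of_nonneg_left hinner (by positivity : 0 ≤ 2 * γ)
  have h2 := mul_le_mul_of_nonneg_left hjensen (by positivity : 0 ≤ 2 * (γ * b))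
  have h3 := mul_le_mul_of_nonneg_left hsq (by positivity : 0 ≤ γ ^ 2)
  linarith

/-- Summing a noisy descent recursion with square-root drift over at most `N` steps. -/
lemma sum_le_of_sqrt_drift_recursion {d G g : ℕ → ℝ} {a b : ℕ} {α β N : ℝ} (hab : a ≤ b)
    (hN : (b : ℝ) - a ≤ N) (hα : 0 ≤ α) (hβ : 0 ≤ β) (hd : ∀ i, 0 ≤ d i)
    (hg : ∀ i ∈ Finset.Ico a b, 0 ≤ g i) (hG : ∀ i ∈ Finset.Ico a b, 0 ≤ G i)
    (hrec : ∀ i ∈ Finset.Ico a b, 2 * g i * G i + d (i + 1) ≤ d i + 2 * α * √(d i) + β) :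
    ∑ i ∈ Finset.Ico a b, 2 * g i * G i ≤
      d a + N * (2 * α * (√(d a) + 2 * (N * α) + √(N * β)) + β) := by
  have hN0 : 0 ≤ N := le_trans (sub_nonneg.2 (by exact_mod_cast hab)) hN
  set M := √(d a) + 2 * (N * α) + √(N * β) with hM
  have hM0 : 0 ≤ M := by positivity
  have hMsq : d a + N * (2 * α * M + β) ≤ M ^ 2 := by
    have h1 := Real.sq_sqrt (hd a)
    have h2 := Real.sq_sqrt (mul_nonneg hN0 hβ)
    have h3 := mul_nonneg hN0 hα
    have h4 := Real.sqrt_nonneg (d a)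
    have h5 := Real.sqrt_nonneg (N * β)
    rw [hM]
    nlinarith [mul_nonneg h3 h4, mul_nonneg h3 h5, mul_nonneg h4 h5, mul_nonneg h3 h3]
  have hstep0 : 0 ≤ 2 * α * M + β := by positivity
  have key : ∀ m, a ≤ m → m ≤ b →
      ∑ i ∈ Finset.Ico a m, 2 * g i * G i + d m ≤ d a + ((m : ℝ) - a) * (2 * α * M + β) := by
    intro m ham
    induction m, ham using Nat.le_induction with
    | base => intro _; simp
    | succ m ham ih =>
      intro hmb
      have ih := ih (by omega)
      have hsum : 0 ≤ ∑ i ∈ Finset.Ico a m, 2 * g i * G i := Finset.sum_nonneg fun i hi => by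
        have hi' : i ∈ Finset.Ico a b := by simp only [Finset.mem_Ico] at hi ⊢; omega
        have := hg i hi'
        have := hG i hi'
        positivity
      have hmN : (m : ℝ) - a ≤ N := by
        have : (m : ℝ) ≤ b := by exact_mod_cast (by omega : m ≤ b)
        linarith
      have hdm : √(d m) ≤ M := by
        refine Real.sqrt_le_iff.2 ⟨hM0, ?_⟩
        have := mul_le_mul_of_nonneg_right hmN hstep0
        linarith
      have hr := hrec m (by simp only [Finset.mem_Ico]; omega)
      rw [Finset.sum_Ico_succ_top ham]
      push_cast
      have := mul_le_mul_of_nonneg_left hdm (by positivity : 0 ≤ 2 * α)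
      linarith
  have hb := key b hab le_rfl
  have := mul_le_mul_of_nonneg_right hN hstep0
  have := hd b
  linarith

/-- Combinatorics of the halving epoch boundaries `k - ⌈k / 2 ^ j⌉`. -/
lemma halving_epoch_boundaries {k n : ℕ} (hk : 2 ≤ k) (hn : n = Nat.clog 2 k) {kk : ℕ → ℕ}
    (hkk : ∀ j ≤ n, kk j = k - Nat.ceil ((k : ℝ) / 2 ^ j)) (hkktop : kk (n + 1) = k) :
    1 ≤ n ∧ kk 0 = 0 ∧ kk n + 1 = k ∧ k ≤ kk 1 + kk 2 ∧ (∀ j ≤ n, kk j < kk (j + 1)) ∧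
      (∀ j ≤ n + 1, kk j ≤ k) ∧ ∀ j < n, 4 * kk (j + 1) ≤ 3 * kk (j + 2) + kk j := by
  set c : ℕ → ℕ := fun j => Nat.ceil ((k : ℝ) / 2 ^ j) with hc
  have hcle : ∀ j m, c j ≤ m ↔ k ≤ m * 2 ^ j := fun j m => by
    rw [hc, Nat.ceil_le, div_le_iff₀ (by positivity)]
    exact_mod_cast Iff.rfl
  have hsucc : ∀ j, c (j + 1) = (c j + 1) / 2 := fun j => by
    have h : ∀ m, c (j + 1) ≤ m ↔ (c j + 1) / 2 ≤ m := fun m => by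
      rw [hcle, pow_succ, show m * (2 ^ j * 2) = (2 * m) * 2 ^ j by ring, ← hcle]
      omega
    exact le_antisymm ((h _).2 le_rfl) ((h _).1 le_rfl)
  have hck : ∀ j, c j ≤ k := fun j => (hcle j k).2 (Nat.le_mul_of_pos_right _ (by positivity))
  have hc0 : c 0 = k := by simp [hc]
  have hn1 : 1 ≤ n := by
    rw [hn]
    exact Nat.clog_pos (by norm_num) hk
  have hcn : c n ≤ 1 := by
    rw [hcle, one_mul, hn]
    exact Nat.le_pow_clog (by norm_num) k
  have hcpos : ∀ j, 1 ≤ c j := fun j => by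
    by_contra h
    have := (hcle j 0).1 (by omega)
    omega
  have hc2 : ∀ j < n, 2 ≤ c j := fun j hj => by
    by_contra h
    have h1 := (hcle j 1).1 (by omega)
    rw [one_mul] at h1
    have h2 := (Nat.clog_le_iff_le_pow (by norm_num)).2 h1
    omega
  have hkk' : ∀ j ≤ n, kk j = k - c j := hkk
  refine ⟨hn1, ?_, ?_, ?_, ?_, ?_, ?_⟩
  · rw [hkk' 0 (by omega), hc0]; omega
  · have := hkk' n le_rfl
    have := hcpos n
    omega
  · have h1 := hkk' 1 hn1
    have h2 := hsucc 0
    have h3 := hsucc 1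
    rcases hn1.eq_or_lt with h | h
    · subst h
      have := hkktop
      simp only [Nat.reduceAdd] at this
      omega
    · have h4 := hkk' 2 h
      have h5 := hc2 1 h
      simp only [zero_add, Nat.reduceAdd] at h2 h3
      omega
  · intro j hj
    have h1 := hkk' j hj
    have h2 := hcpos j
    have h3 := hck j
    rcases hj.eq_or_lt with h | h
    · subst h
      omega
    · have h4 := hkk' (j + 1) h
      have h5 := hsucc j
      have h6 := hc2 j h
      omega
  · intro j hj
    rcases hj.eq_or_lt with h | h
    · exact (h ▸ hkktop).le
    · have := hkk' j (by omega)
      omega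
  · intro j hj
    have h1 := hkk' j hj.le
    have h2 := hkk' (j + 1) hj
    have h3 := hsucc j
    have h4 := hsucc (j + 1)
    have h5 := hck j
    have h6 := hc2 j hj
    rcases Nat.eq_or_lt_of_le (Nat.succ_le_of_lt hj) with h | h
    · have h7 : kk (j + 2) = k := by rw [← hkktop, ← h]
      have h8 : c (j + 1) ≤ 1 := by rw [← Nat.succ_eq_add_one, h]; exact hcn
      omega
    · have h7 := hkk' (j + 2) h
      have h8 := hc2 (j + 1) h
      simp only [add_assoc, Nat.reduceAdd] at h4
      omega

/-- Drift and noise of one epoch of the schedule in terms of the horizon `k`. -/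
lemma epoch_schedule_bounds {p γ₀ l₀ M₀ a b k r : ℝ} (hp1 : 1 < p) (hp2 : p ≤ 2) (hγ : 0 < γ₀)
    (hl : 0 < l₀) (hM : 0 < M₀) (ha : 0 ≤ a) (hb : 0 ≤ b) (hk : 1 ≤ k) (hr : 0 < r) :
    γ₀ / (r * k ^ (1 / p)) * (a * (r * max M₀ (l₀ * k ^ (1 / p))) ^ (1 - p)) ≤
        γ₀ * (4 * a / l₀ ^ (p - 1)) / 4 * (r ^ (-p) / k) ∧
      (γ₀ / (r * k ^ (1 / p))) ^ 2 * (b * (r * max M₀ (l₀ * k ^ (1 / p))) ^ (2 - p)) ≤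
        γ₀ ^ 2 * (b * max M₀ l₀ ^ (2 - p)) * (r ^ (-p) / k) := by
  set K := k ^ (1 / p) with hK
  have hk0 : 0 < k := by linarith
  have hK0 : 0 < K := by positivity
  have hK1 : 1 ≤ K := Real.one_le_rpow hk (by positivity)
  have hrK : (r * K) ^ (-p) = r ^ (-p) / k := by
    rw [Real.mul_rpow hr.le hK0.le, hK, ← Real.rpow_mul hk0.le,
      show 1 / p * -p = -1 by field_simp, Real.rpow_neg_one, div_eq_mul_inv]
  rw [← hrK]
  constructor
  · have h1 : (r * max M₀ (l₀ * K)) ^ (1 - p) ≤ (r * K * l₀) ^ (1 - p) := by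
      refine Real.rpow_le_rpow_of_nonpos (by positivity) ?_ (by linarith)
      rw [mul_assoc, mul_comm K]
      exact mul_le_mul_of_nonneg_left (le_max_right _ _) hr.le
    have h2 : (r * K * l₀) ^ (1 - p) = r * K * (r * K) ^ (-p) / l₀ ^ (p - 1) := by
      rw [Real.mul_rpow (by positivity) hl.le, show 1 - p = 1 + -p by ring,
        Real.rpow_add (by positivity), Real.rpow_one, show 1 + -p = -(p - 1) by ring,
        Real.rpow_neg hl.le, div_eq_mul_inv]
    calc _ ≤ γ₀ / (r * K) * (a * (r * K * (r * K) ^ (-p) / l₀ ^ (p - 1))) := by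
          rw [← h2]; gcongr
      _ = _ := by field_simp
  · have h1 : (r * max M₀ (l₀ * K)) ^ (2 - p) ≤ (r * K * max M₀ l₀) ^ (2 - p) := by
      refine Real.rpow_le_rpow (by positivity) ?_ (by linarith)
      rw [mul_assoc]
      refine mul_le_mul_of_nonneg_left (max_le ?_ ?_) hr.le
      · nlinarith [le_max_left M₀ l₀]
      · nlinarith [le_max_right M₀ l₀]
    have h2 : (r * K * max M₀ l₀) ^ (2 - p) =
        (r * K) ^ 2 * (r * K) ^ (-p) * max M₀ l₀ ^ (2 - p) := by
      rw [Real.mul_rpow (by positivity) (by positivity), show 2 - p = 2 + -p by ring,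
        Real.rpow_add (by positivity : 0 < r * K), Real.rpow_two]
    calc _ ≤ (γ₀ / (r * K)) ^ 2 * (b * ((r * K) ^ 2 * (r * K) ^ (-p) * max M₀ l₀ ^ (2 - p))) := by
          rw [← h2]; gcongr
      _ = _ := by field_simp

/-- Accumulated drift and noise of a run in which both are proportional to `q ≤ 1`. -/
lemma drift_noise_le {γ v w q D A B : ℝ} (hγ : 0 < γ) (hv : 0 ≤ v) (hw : 0 ≤ w) (hq : 0 ≤ q)
    (hq1 : q ≤ 1) (hA : A = γ * v / 4 * q) (hB : B = γ ^ 2 * w * q) :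
    2 * A * (D + 2 * A + √B) + B ≤ q * (γ * v * D / 2 + γ ^ 2 * (v + √w) ^ 2) := by
  have h1 : √B ≤ γ * √w := by
    refine Real.sqrt_le_iff.2 ⟨by positivity, ?_⟩
    rw [hB, mul_pow, Real.sq_sqrt hw]
    exact mul_le_of_le_one_right (by positivity) hq1
  have h2 : A ≤ γ * v / 4 := hA ▸ mul_le_of_le_one_right (by positivity) hq1
  have hA0 : 0 ≤ A := hA ▸ by positivity
  have hw' := Real.sqrt_nonneg w
  calc 2 * A * (D + 2 * A + √B) + B ≤ 2 * A * (D + 2 * (γ * v / 4) + γ * √w) + B := by gcongr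
    _ = q * (γ * v * D / 2 + γ ^ 2 * (v ^ 2 / 4 + v * √w / 2 + √w ^ 2)) := by
      rw [hA, hB, Real.sq_sqrt hw]; ring
    _ ≤ _ := by
      gcongr
      nlinarith [mul_nonneg hv hw', sq_nonneg v]

/-- Last-iterate bound over halving epochs: the step sizes halve from one epoch to the next and
the drift and noise decay by the factor `ρ`. -/
lemma last_iterate_le_of_halving_epochs {F e g α β : ℕ → ℝ} {d : ℕ → ℕ → ℝ} {kk : ℕ → ℕ}
    {k n : ℕ} {fs γ K v w ρ : ℝ} (hk : 1 ≤ k) (hγ : 0 < γ) (hK : 0 < K) (hv : 0 ≤ v) (hw : 0 ≤ w)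
    (hρ : 0 ≤ ρ) (hρ1 : ρ ≤ 1) (hn : 1 ≤ n) (hkk0 : kk 0 = 0) (hkkn : kk n + 1 = k)
    (hkk12 : k ≤ kk 1 + kk 2) (hlt : ∀ j ≤ n, kk j < kk (j + 1)) (hle : ∀ j ≤ n + 1, kk j ≤ k)
    (hratio : ∀ j < n, 4 * kk (j + 1) ≤ 3 * kk (j + 2) + kk j)
    (hd : ∀ r i, 0 ≤ d r i) (hdd : ∀ r, d r r = 0) (he : ∀ i, 0 ≤ e i)
    (hfs : ∀ i, 1 ≤ i → fs ≤ F i)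
    (hrec : ∀ r i, 1 ≤ r → r ≤ i →
      2 * g i * (F i - F r) + d r (i + 1) ≤ d r i + 2 * α i * √(d r i) + β i)
    (hrecs : ∀ i, 1 ≤ i → 2 * g i * (F i - fs) + e (i + 1) ≤ e i + 2 * α i * √(e i) + β i)
    (hg : ∀ j ≤ n, ∀ i ∈ Finset.Icc (kk j + 1) (kk (j + 1)), g i = γ / (2 ^ j * K))
    (hα : ∀ j ≤ n, ∀ i ∈ Finset.Icc (kk j + 1) (kk (j + 1)), α i ≤ γ * v / 4 * (ρ ^ j / k))
    (hβ : ∀ j ≤ n, ∀ i ∈ Finset.Icc (kk j + 1) (kk (j + 1)), β i ≤ γ ^ 2 * w * (ρ ^ j / k)) :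
    F k - fs ≤ K / k * (e 1 / γ + v * √(e 1) / 2 + γ * (v + √w) ^ 2 +
      4 * γ * (v + √w) ^ 2 * ∑ j ∈ Finset.range n, (2 * ρ) ^ j) := by
  have hk0 : (0 : ℝ) < k := by exact_mod_cast hk
  set Q := (v + √w) ^ 2 with hQ
  have hQ0 : 0 ≤ Q := by positivity
  have hjj : ∀ j, kk (j + 1 + 1) = kk (j + 2) := fun _ => rfl
  have hne : ∀ j ≤ n, (Finset.Icc (kk j + 1) (kk (j + 1))).Nonempty := fun j hj =>
    Finset.nonempty_Icc.2 (hlt j hj)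
  have hex : ∀ j, ∃ s, j ≤ n → s ∈ Finset.Icc (kk j + 1) (kk (j + 1)) ∧
      ∀ i ∈ Finset.Icc (kk j + 1) (kk (j + 1)), F s ≤ F i := fun j => by
    by_cases hj : j ≤ n
    · obtain ⟨s, hs, hmin⟩ := Finset.exists_min_image _ F (hne j hj)
      exact ⟨s, fun _ => ⟨hs, hmin⟩⟩
    · exact ⟨0, fun h => absurd h hj⟩
  choose s hs using hex
  have hα' : ∀ j < n, ∀ i ∈ Finset.Icc (kk j + 1) (kk (j + 2)), α i ≤ γ * v / 4 * (ρ ^ j / k) := by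
    intro j hj i hi
    by_cases h : i ≤ kk (j + 1)
    · exact hα j hj.le i (by simp only [Finset.mem_Icc] at hi ⊢; omega)
    · refine (hα (j + 1) hj i (by simp only [Finset.mem_Icc, hjj] at hi ⊢; omega)).trans ?_
      gcongr ?_ * (?_ / ?_)
      exact pow_le_pow_of_le_one hρ hρ1 (Nat.le_succ j)
  have hβ' : ∀ j < n, ∀ i ∈ Finset.Icc (kk j + 1) (kk (j + 2)),
      β i ≤ γ ^ 2 * w * (ρ ^ j / k) := by
    intro j hj i hi
    by_cases h : i ≤ kk (j + 1)
    · exact hβ j hj.le i (by simp only [Finset.mem_Icc] at hi ⊢; omega)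
    · refine (hβ (j + 1) hj i (by simp only [Finset.mem_Icc, hjj] at hi ⊢; omega)).trans ?_
      gcongr ?_ * (?_ / ?_)
      exact pow_le_pow_of_le_one hρ hρ1 (Nat.le_succ j)
  have hg0 : ∀ j < n, ∀ i ∈ Finset.Icc (kk j + 1) (kk (j + 2)), 0 ≤ g i := by
    intro j hj i hi
    by_cases h : i ≤ kk (j + 1)
    · rw [hg j hj.le i (by simp only [Finset.mem_Icc] at hi ⊢; omega)]
      positivity
    · rw [hg (j + 1) hj i (by simp only [Finset.mem_Icc, hjj] at hi ⊢; omega)]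
      positivity
  have hstep : ∀ j < n, F (s (j + 1)) ≤ F (s j) + K / k * (4 * γ * Q) * (2 * ρ) ^ j := by
    intro j hj
    rcases le_total (F (s (j + 1))) (F (s j)) with h | h
    · have : 0 ≤ K / k * (4 * γ * Q) * (2 * ρ) ^ j := by positivity
      linarith
    obtain ⟨hsj, hminj⟩ := hs j hj.le
    obtain ⟨-, hmins⟩ := hs (j + 1) hj
    have hj1 := hlt j hj.le
    have hj2 : kk (j + 1) < kk (j + 2) := hlt (j + 1) hj
    have hjk := hle (j + 2) (by omega)
    have hrj := hratio j hj
    rw [Finset.mem_Icc] at hsj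
    have hmem : ∀ i ∈ Finset.Ico (s j) (kk (j + 2) + 1), i ∈ Finset.Icc (kk j + 1) (kk (j + 2)) :=
      fun i hi => by simp only [Finset.mem_Icc, Finset.mem_Ico] at hi ⊢; omega
    have hG : ∀ i ∈ Finset.Ico (s j) (kk (j + 2) + 1), 0 ≤ F i - F (s j) := by
      intro i hi
      rw [Finset.mem_Ico] at hi
      by_cases hij : i ≤ kk (j + 1)
      · exact sub_nonneg.2 (hminj i (by rw [Finset.mem_Icc]; omega))
      · exact sub_nonneg.2 (h.trans (hmins i (by rw [Finset.mem_Icc, hjj]; omega)))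
    set N : ℝ := (kk (j + 2) : ℝ) - kk j with hN
    have hNpos : 0 ≤ N := sub_nonneg.2 (by exact_mod_cast (by omega : kk j ≤ kk (j + 2)))
    have hNk : N ≤ k := by
      have : (kk (j + 2) : ℝ) ≤ k := by exact_mod_cast hjk
      have : (0 : ℝ) ≤ kk j := by positivity
      linarith
    have hsum := sum_le_of_sqrt_drift_recursion (d := d (s j)) (G := fun i => F i - F (s j))
      (g := g) (a := s j) (b := kk (j + 2) + 1) (α := γ * v / 4 * (ρ ^ j / k))
      (β := γ ^ 2 * w * (ρ ^ j / k)) (N := N) (by omega)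
      (by
        have : ((kk j + 1 : ℕ) : ℝ) ≤ s j := by exact_mod_cast hsj.1
        push_cast at this ⊢
        linarith) (by positivity) (by positivity) (hd _)
      (fun i hi => hg0 j hj i (hmem i hi)) hG
      (fun i hi => by
        have h1 := hrec (s j) i (by omega) (Finset.mem_Ico.1 hi).1
        have h2 := hα' j hj i (hmem i hi)
        have h3 := hβ' j hj i (hmem i hi)
        have h4 := mul_le_mul_of_nonneg_right h2 (Real.sqrt_nonneg (d (s j) i))
        linarith)
    rw [hdd, Real.sqrt_zero] at hsum
    have hq1 : N * ρ ^ j / k ≤ 1 := by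
      rw [div_le_one hk0]
      exact (mul_le_of_le_one_right hNpos (pow_le_one₀ hρ hρ1)).trans hNk
    have hnoise := drift_noise_le (D := 0) (q := N * ρ ^ j / k) hγ hv hw (by positivity) hq1
      (A := N * (γ * v / 4 * (ρ ^ j / k))) (B := N * (γ ^ 2 * w * (ρ ^ j / k)))
      (by ring) (by ring)
    set W : ℝ := (kk (j + 2) : ℝ) - kk (j + 1) with hW
    have hW0 : 0 < W := sub_pos.2 (by exact_mod_cast hj2)
    have hNW : N ≤ 4 * W := by
      have : 4 * (kk (j + 1) : ℝ) ≤ 3 * kk (j + 2) + kk j := by exact_mod_cast hrj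
      linarith
    have hlower : W * (2 * (γ / (2 ^ (j + 1) * K)) * (F (s (j + 1)) - F (s j))) ≤
        ∑ i ∈ Finset.Ico (s j) (kk (j + 2) + 1), 2 * g i * (F i - F (s j)) := by
      calc _ = ∑ i ∈ Finset.Ico (kk (j + 1) + 1) (kk (j + 2) + 1),
            2 * (γ / (2 ^ (j + 1) * K)) * (F (s (j + 1)) - F (s j)) := by
            rw [Finset.sum_const, Nat.card_Ico, nsmul_eq_mul, Nat.add_sub_add_right,
              Nat.cast_sub hj2.le]
        _ ≤ ∑ i ∈ Finset.Ico (kk (j + 1) + 1) (kk (j + 2) + 1), 2 * g i * (F i - F (s j)) := by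
            refine Finset.sum_le_sum fun i hi => ?_
            have hi' : i ∈ Finset.Icc (kk (j + 1) + 1) (kk (j + 1 + 1)) := by
              simp only [Finset.mem_Ico, Finset.mem_Icc, add_assoc, Nat.reduceAdd] at hi ⊢
              omega
            rw [hg (j + 1) hj i hi']
            gcongr
            exact hmins i hi'
        _ ≤ _ := by
            refine Finset.sum_le_sum_of_subset_of_nonneg (fun i hi => ?_) fun i hi _ =>
              mul_nonneg (mul_nonneg (by norm_num) (hg0 j hj i (hmem i hi))) (hG i hi)
            simp only [Finset.mem_Ico] at hi ⊢
            omega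
    have hfin : W * (2 * (γ / (2 ^ (j + 1) * K)) * (F (s (j + 1)) - F (s j))) ≤
        (4 * W) * ρ ^ j / k * (γ ^ 2 * Q) := by
      have h1 : N * ρ ^ j / k * (γ ^ 2 * Q) ≤ (4 * W) * ρ ^ j / k * (γ ^ 2 * Q) := by gcongr
      linarith
    have hc : 0 < W * γ / (2 ^ j * K) := by positivity
    have h2 : W * (2 * (γ / (2 ^ (j + 1) * K)) * (F (s (j + 1)) - F (s j))) =
        W * γ / (2 ^ j * K) * (F (s (j + 1)) - F (s j)) := by
      rw [pow_succ]; field_simp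
    have h3 : (4 * W) * ρ ^ j / k * (γ ^ 2 * Q) =
        W * γ / (2 ^ j * K) * (K / k * (4 * γ * Q) * (2 * ρ) ^ j) := by
      rw [mul_pow]; field_simp
    rw [h2, h3] at hfin
    linarith [le_of_mul_le_mul_left hfin hc]
  set T := K / k * (e 1 / γ + v * √(e 1) / 2 + γ * Q) with hT
  have hinit : min (F (s 0)) (F (s 1)) ≤ fs + T := by
    obtain ⟨hs0, hmin0⟩ := hs 0 (by omega)
    obtain ⟨hs1, hmin1⟩ := hs 1 hn
    simp only [hkk0, zero_add, Nat.reduceAdd] at hs0 hmin0 hs1 hmin1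
    have h01 := hlt 0 (by omega)
    have h12 : kk 1 < kk 2 := hlt 1 hn
    have h2k := hle 2 (by omega)
    simp only [hkk0, zero_add] at h01
    have hmem : ∀ i ∈ Finset.Ico 1 (kk 2 + 1), i ∈ Finset.Icc (kk 0 + 1) (kk (0 + 2)) :=
      fun i hi => by
        simp only [Finset.mem_Icc, Finset.mem_Ico, hkk0, zero_add] at hi ⊢
        omega
    have hsum := sum_le_of_sqrt_drift_recursion (d := e) (G := fun i => F i - fs)
      (g := g) (a := 1) (b := kk 2 + 1) (α := γ * v / 4 * (ρ ^ 0 / k))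
      (β := γ ^ 2 * w * (ρ ^ 0 / k)) (N := k) (by omega)
      (by
        have : (kk 2 : ℝ) ≤ k := by exact_mod_cast h2k
        push_cast
        linarith) (by positivity) (by positivity) he
      (fun i hi => hg0 0 hn i (hmem i hi))
      (fun i hi => sub_nonneg.2 (hfs i (Finset.mem_Ico.1 hi).1))
      (fun i hi => by
        have h1 := hrecs i (Finset.mem_Ico.1 hi).1
        have h2 := hα' 0 hn i (hmem i hi)
        have h3 := hβ' 0 hn i (hmem i hi)
        have h4 := mul_le_mul_of_nonneg_right h2 (Real.sqrt_nonneg (e i))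
        linarith)
    have hnoise := drift_noise_le (D := √(e 1)) (q := 1) hγ hv hw (by norm_num) le_rfl
      (A := k * (γ * v / 4 * (ρ ^ 0 / k))) (B := k * (γ ^ 2 * w * (ρ ^ 0 / k)))
      (by field_simp) (by field_simp)
    set Δ := min (F (s 0)) (F (s 1)) - fs with hΔ
    have hΔ0 : 0 ≤ Δ := by
      rw [Finset.mem_Icc] at hs0 hs1
      exact sub_nonneg.2 (le_min (hfs _ (by omega)) (hfs _ (by omega)))
    have hlower : (kk 1 : ℝ) * (2 * (γ / (2 ^ 0 * K)) * Δ) +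
        ((kk 2 : ℝ) - kk 1) * (2 * (γ / (2 ^ 1 * K)) * Δ) ≤
        ∑ i ∈ Finset.Ico 1 (kk 2 + 1), 2 * g i * (F i - fs) := by
      rw [← Finset.sum_Ico_consecutive _ (by omega : 1 ≤ kk 1 + 1)
        (by omega : kk 1 + 1 ≤ kk 2 + 1)]
      have hcard1 : (kk 1 : ℝ) * (2 * (γ / (2 ^ 0 * K)) * Δ) =
          ∑ i ∈ Finset.Ico 1 (kk 1 + 1), 2 * (γ / (2 ^ 0 * K)) * Δ := by
        rw [Finset.sum_const, Nat.card_Ico, nsmul_eq_mul, Nat.add_sub_cancel]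
      have hcard2 : ((kk 2 : ℝ) - kk 1) * (2 * (γ / (2 ^ 1 * K)) * Δ) =
          ∑ i ∈ Finset.Ico (kk 1 + 1) (kk 2 + 1), 2 * (γ / (2 ^ 1 * K)) * Δ := by
        rw [Finset.sum_const, Nat.card_Ico, nsmul_eq_mul, Nat.add_sub_add_right,
          Nat.cast_sub h12.le]
      rw [hcard1, hcard2]
      refine add_le_add (Finset.sum_le_sum fun i hi => ?_) (Finset.sum_le_sum fun i hi => ?_)
      · rw [hg 0 (by omega) i (by
          simp only [Finset.mem_Ico, Finset.mem_Icc, hkk0, zero_add] at hi ⊢; omega)]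
        have := hmin0 i (by simp only [Finset.mem_Ico, Finset.mem_Icc] at hi ⊢; omega)
        have := min_le_left (F (s 0)) (F (s 1))
        gcongr
        linarith
      · rw [hg 1 hn i (by
          simp only [Finset.mem_Ico, Finset.mem_Icc, Nat.reduceAdd] at hi ⊢; omega)]
        have := hmin1 i (by simp only [Finset.mem_Ico, Finset.mem_Icc] at hi ⊢; omega)
        have := min_le_right (F (s 0)) (F (s 1))
        gcongr
        linarith
    have hweight : k * (γ / K) * Δ ≤ (kk 1 : ℝ) * (2 * (γ / (2 ^ 0 * K)) * Δ) +
        ((kk 2 : ℝ) - kk 1) * (2 * (γ / (2 ^ 1 * K)) * Δ) := by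
      have h1 : (k : ℝ) ≤ kk 1 + kk 2 := by exact_mod_cast hkk12
      calc _ ≤ ((kk 1 : ℝ) + kk 2) * (γ / K) * Δ := by gcongr
        _ = _ := by field_simp; ring
    have hc : 0 < k * (γ / K) := by positivity
    have hsq := Real.sq_sqrt (he 1)
    have hTeq : k * (γ / K) * T = e 1 + (γ * v * √(e 1) / 2 + γ ^ 2 * Q) := by
      rw [hT]; field_simp; ring
    have : k * (γ / K) * Δ ≤ k * (γ / K) * T := by
      rw [hTeq]
      linarith
    linarith [le_of_mul_le_mul_left this hc]
  have hchain : ∀ m, 1 ≤ m → m ≤ n →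
      F (s m) ≤ fs + T + ∑ j ∈ Finset.range m, K / k * (4 * γ * Q) * (2 * ρ) ^ j := by
    intro m hm
    induction m, hm using Nat.le_induction with
    | base =>
      intro _
      have h0 := hstep 0 hn
      have h1 : 0 ≤ K / k * (4 * γ * Q) * (2 * ρ) ^ 0 := by positivity
      simp only [zero_add] at h0
      rw [Finset.sum_range_one]
      rcases min_choice (F (s 0)) (F (s 1)) with h | h <;> rw [h] at hinit <;> linarith
    | succ m hm ih =>
      intro hmn
      have h1 := ih (by omega)
      have h2 := hstep m (by omega)
      rw [Finset.sum_range_succ]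
      linarith
  have hsn : s n = k := by
    have h1 := (hs n le_rfl).1
    have h2 := hle (n + 1) le_rfl
    rw [Finset.mem_Icc] at h1
    omega
  have hlast := hchain n hn le_rfl
  rw [hsn, ← Finset.mul_sum] at hlast
  rw [hT] at hlast
  linarith

theorem clipped_ssgm_last_iterate_finite_horizon
    {H : Type*} [NormedAddCommGroup H] [InnerProductSpace ℝ H]
    [CompleteSpace H] [SecondCountableTopology H]
    {Ω : Type*} [mΩ : MeasurableSpace Ω] (μ : Measure Ω) [IsProbabilityMeasure μ]
    (X : Set H) (hXne : X.Nonempty) (hXcl : IsClosed X) (hXcv : Convex ℝ X)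
    (f : H → ℝ) (hfcv : ConvexOn ℝ Set.univ f)
    (L : ℝ) (hL : 0 < L) (hfLip : LipschitzWith L.toNNReal f)
    (xstar : H) (hxs : xstar ∈ X) (hxsmin : ∀ y ∈ X, f xstar ≤ f y)
    (p ε σm : ℝ) (hp1 : 1 < p) (hp2 : p ≤ 2) (hε : 0 < ε) (hσm : 0 ≤ σm)
    (Lε ap bp : ℝ)
    (hLε : Lε = (1 + ε) * L)
    (hap : ap = (1 + 1 / ε) ^ (p - 1) * σm ^ p)
    (hbp : bp = (2 : ℝ) ^ (p - 1) * (σm ^ p + L ^ p))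
    (ℱ : ℕ → MeasurableSpace Ω) (hℱ : ∀ k, ℱ k ≤ mΩ) (hℱmono : Monotone ℱ)
    (γ lam : ℕ → ℝ)
    (hγpos : ∀ k, 1 ≤ k → 0 < γ k)
    (hlamLε : ∀ k, 1 ≤ k → Lε ≤ lam k)
    (x u ut : ℕ → Ω → H)
    (x1 : H) (hx1 : ∀ ω, x 1 ω = x1) (hx1X : x1 ∈ X)
    (hxmeas : ∀ k, 1 ≤ k → StronglyMeasurable[ℱ k] (x k))
    (hxX : ∀ k, 1 ≤ k → ∀ ω, x k ω ∈ X)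
    (hxint : ∀ k, 1 ≤ k → Integrable (fun ω => ‖x k ω‖ ^ 2) μ)
    (humeas : ∀ k, 1 ≤ k → StronglyMeasurable[ℱ k] (u k))
    (husub : ∀ k, 1 ≤ k → ∀ᵐ ω ∂μ, ∀ y : H,
      f (x k ω) + ⟪u k ω, y - x k ω⟫ ≤ f y)
    (hutmeas : ∀ k, 1 ≤ k → StronglyMeasurable[ℱ (k + 1)] (ut k))
    (hutbdd : ∀ k, 1 ≤ k → ∀ᵐ ω ∂μ, ‖ut k ω‖ ≤ lam k)
    (hbias : ∀ k, 1 ≤ k →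
      ∀ᵐ ω ∂μ, ‖(μ[ut k | ℱ k]) ω - u k ω‖ ≤ ap * lam k ^ (1 - p))
    (hmom : ∀ k, 1 ≤ k →
      ∀ᵐ ω ∂μ, (μ[(fun ω' => ‖ut k ω'‖ ^ 2) | ℱ k]) ω ≤ bp * lam k ^ (2 - p))
    (hproj : ∀ k, 1 ≤ k → ∀ ω, x (k + 1) ω ∈ X ∧
      ∀ y ∈ X, ‖x (k + 1) ω - (x k ω - γ k • ut k ω)‖ ≤ ‖y - (x k ω - γ k • ut k ω)‖)
    (k : ℕ) (hk : 2 ≤ k)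
    (n : ℕ) (hn : n = Nat.clog 2 k)
    (kk : ℕ → ℕ)
    (hkk : ∀ j ≤ n, kk j = k - Nat.ceil ((k : ℝ) / 2 ^ j))
    (hkktop : kk (n + 1) = k)
    (γ0 lam0 : ℝ) (hγ0 : 0 < γ0) (hlam0 : 0 < lam0)
    (hsched : ∀ j ≤ n, ∀ i ∈ Finset.Icc (kk j + 1) (kk (j + 1)),
      γ i = γ0 / ((2 : ℝ) ^ j * (k : ℝ) ^ (1 / p)) ∧
      lam i = (2 : ℝ) ^ j * max Lε (lam0 * (k : ℝ) ^ (1 / p)))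
    (vp wp : ℝ) (hvp : vp = 4 * ap / lam0 ^ (p - 1))
    (hwp : wp = bp * (max Lε lam0) ^ (2 - p)) :
    (∫ ω, f (x k ω) ∂μ) - f xstar ≤
      (1 / (k : ℝ) ^ ((p - 1) / p)) *
        ((6 / 5) * ‖x1 - xstar‖ ^ 2 / γ0 +
          (53 / 10) * ((2 : ℝ) ^ (p - 1) / ((2 : ℝ) ^ (p - 1) - 1)) *
            (‖x1 - xstar‖ * vp + γ0 * (vp + Real.sqrt wp) ^ 2)) := by
  have hkr : (1 : ℝ) ≤ k := by exact_mod_cast (by omega : 1 ≤ k)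
  have hk0 : (0 : ℝ) < k := by linarith
  have hLε0 : 0 < Lε := hLε ▸ by positivity
  have hap0 : 0 ≤ ap := hap ▸ by positivity
  have hbp0 : 0 ≤ bp := hbp ▸ by positivity
  have hv : 0 ≤ vp := hvp ▸ by positivity
  have hw : 0 ≤ wp := hwp ▸ by positivity
  have hlam : ∀ i, 1 ≤ i → 0 < lam i := fun i hi => hLε0.trans_le (hlamLε i hi)
  have hx2 : ∀ i, 1 ≤ i → MemLp (x i) 2 μ := fun i hi =>
    (memLp_two_iff_integrable_sq_norm ((hxmeas i hi).mono (hℱ i)).aestronglyMeasurable).2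
      (hxint i hi)
  have hfint : ∀ i, 1 ≤ i → Integrable (fun ω => f (x i ω)) μ := fun i hi => by
    refine (((hx2 i hi).integrable (by norm_num)).norm.const_mul L |>.add
      (integrable_const ‖f 0‖)).mono'
      (hfLip.continuous.comp_aestronglyMeasurable (hx2 i hi).1) (.of_forall fun ω => ?_)
    have h := hfLip.dist_le_mul (x i ω) 0
    rw [Real.coe_toNNReal _ hL.le, dist_zero_right, dist_eq_norm] at h
    have h' := norm_le_norm_sub_add (f (x i ω)) (f 0)
    simp only [Pi.add_apply]
    linarith
  have hstep : ∀ (i : ℕ) (z : Ω → H), 1 ≤ i → StronglyMeasurable[ℱ i] z → MemLp z 2 μ →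
      Integrable (fun ω => f (z ω)) μ → (∀ ω, z ω ∈ X) →
      2 * γ i * ((∫ ω, f (x i ω) ∂μ) - ∫ ω, f (z ω) ∂μ) + ∫ ω, ‖x (i + 1) ω - z ω‖ ^ 2 ∂μ ≤
        (∫ ω, ‖x i ω - z ω‖ ^ 2 ∂μ) +
          2 * (γ i * (ap * lam i ^ (1 - p))) * √(∫ ω, ‖x i ω - z ω‖ ^ 2 ∂μ) +
          γ i ^ 2 * (bp * lam i ^ (2 - p)) := by
    intro i z hi hz hz2 hfz hzX
    exact expected_projected_subgradient_step μ (hℱ i) hXcv (hγpos i hi)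
      (mul_nonneg hap0 (Real.rpow_nonneg (hlam i hi).le _)) (hxmeas i hi) hz (hx2 i hi) hz2
      (hx2 (i + 1) (by omega)) (hfint i hi) hfz hzX (husub i hi)
      ((hutmeas i hi).mono (hℱ (i + 1))).aestronglyMeasurable (hutbdd i hi) (hbias i hi)
      (hmom i hi) (hproj i hi)
  have hsched_bounds : ∀ j ≤ n, ∀ i ∈ Finset.Icc (kk j + 1) (kk (j + 1)),
      γ i * (ap * lam i ^ (1 - p)) ≤ γ0 * vp / 4 * (((2 : ℝ) ^ (-p)) ^ j / k) ∧
      γ i ^ 2 * (bp * lam i ^ (2 - p)) ≤ γ0 ^ 2 * wp * (((2 : ℝ) ^ (-p)) ^ j / k) := by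
    intro j hj i hi
    obtain ⟨h1, h2⟩ := hsched j hj i hi
    have h3 : ((2 : ℝ) ^ (-p)) ^ j = ((2 : ℝ) ^ j) ^ (-p) := by
      rw [← Real.rpow_natCast, ← Real.rpow_natCast, ← Real.rpow_mul (by norm_num),
        ← Real.rpow_mul (by norm_num), mul_comm]
    rw [h1, h2, h3, hvp, hwp]
    exact epoch_schedule_bounds hp1 hp2 hγ0 hlam0 hLε0 hap0 hbp0 hkr (by positivity)
  obtain ⟨hn1, hkk0, hkkn, hkk12, hlt, hle, hratio⟩ := halving_epoch_boundaries hk hn hkk hkktop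
  have hmain := last_iterate_le_of_halving_epochs (F := fun i => ∫ ω, f (x i ω) ∂μ)
    (fs := f xstar) (d := fun r i => ∫ ω, ‖x i ω - x r ω‖ ^ 2 ∂μ)
    (e := fun i => ∫ ω, ‖x i ω - xstar‖ ^ 2 ∂μ) (g := γ)
    (α := fun i => γ i * (ap * lam i ^ (1 - p))) (β := fun i => γ i ^ 2 * (bp * lam i ^ (2 - p)))
    (K := (k : ℝ) ^ (1 / p)) (ρ := (2 : ℝ) ^ (-p)) (by omega) hγ0 (by positivity) hv hw
    (by positivity) (Real.rpow_le_one_of_one_le_of_nonpos (by norm_num) (by linarith))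
    hn1 hkk0 hkkn hkk12 hlt hle hratio
    (fun r i => integral_nonneg fun ω => by positivity) (fun r => by simp)
    (fun i => integral_nonneg fun ω => by positivity)
    (fun i hi => by
      calc f xstar = ∫ _, f xstar ∂μ := by simp
        _ ≤ _ := integral_mono (integrable_const _) (hfint i hi) fun ω => hxsmin _ (hxX i hi ω))
    (fun r i hr hri => hstep i (x r) (hr.trans hri) ((hxmeas r hr).mono (hℱmono hri)) (hx2 r hr)
      (hfint r hr) (hxX r hr))
    (fun i hi => by
      simpa using hstep i (fun _ => xstar) hi stronglyMeasurable_const (memLp_const _)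
        (integrable_const _) fun _ => hxs)
    (fun j hj i hi => (hsched j hj i hi).1)
    (fun j hj i hi => (hsched_bounds j hj i hi).1) (fun j hj i hi => (hsched_bounds j hj i hi).2)
  have he1 : ∫ ω, ‖x 1 ω - xstar‖ ^ 2 ∂μ = ‖x1 - xstar‖ ^ 2 := by simp [hx1]
  simp only [he1, Real.sqrt_sq (norm_nonneg _)] at hmain
  have hc : (k : ℝ) ^ (1 / p) / k = 1 / (k : ℝ) ^ ((p - 1) / p) := by
    rw [div_eq_div_iff (by positivity) (by positivity), one_mul, ← Real.rpow_add hk0,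
      show 1 / p + (p - 1) / p = 1 by field_simp; ring, Real.rpow_one]
  rw [hc] at hmain
  have ht1 : 1 < (2 : ℝ) ^ (p - 1) := Real.one_lt_rpow (by norm_num) (by linarith)
  set G := (2 : ℝ) ^ (p - 1) / ((2 : ℝ) ^ (p - 1) - 1) with hG
  have hθ : 2 * (2 : ℝ) ^ (-p) = ((2 : ℝ) ^ (p - 1))⁻¹ := by
    rw [← Real.rpow_neg (by norm_num), show -(p - 1) = 1 + -p by ring,
      Real.rpow_add (by norm_num), Real.rpow_one]
  have hgeom : ∑ j ∈ Finset.range n, (2 * (2 : ℝ) ^ (-p)) ^ j ≤ G := by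
    have hθ1 : ((2 : ℝ) ^ (p - 1))⁻¹ < 1 := inv_lt_one_of_one_lt₀ ht1
    have hθ0 : 0 ≤ ((2 : ℝ) ^ (p - 1))⁻¹ := by positivity
    rw [hθ]
    refine ((summable_geometric_of_lt_one hθ0 hθ1).sum_le_tsum _
      fun j _ => pow_nonneg hθ0 j).trans_eq ?_
    have : (2 : ℝ) ^ (p - 1) - 1 ≠ 0 := by linarith
    rw [tsum_geometric_of_lt_one hθ0 hθ1, hG]
    field_simp
  have hG1 : 1 ≤ G := by
    rw [hG, one_le_div (by linarith)]
    linarith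
  refine hmain.trans (mul_le_mul_of_nonneg_left ?_ (by positivity))
  set Q := (vp + √wp) ^ 2 with hQ
  have hγQ : 0 ≤ γ0 * Q := by positivity
  have hDv : 0 ≤ ‖x1 - xstar‖ * vp := by positivity
  have hD : 0 ≤ ‖x1 - xstar‖ ^ 2 / γ0 := by positivity
  have h1 := mul_le_mul_of_nonneg_left hgeom hγQ
  have h2 := mul_le_mul_of_nonneg_left hG1 hγQ
  have h3 := mul_le_mul_of_nonneg_left hG1 hDv
  rw [mul_div_assoc (6 / 5)]
  linarith
end

section
/- Under the clipped stochastic subgradient setup with the anytime parameter schedule, the last iterate satisfies, for every k ≥ 1, E[f(x_k)] − f* ≤ ((1+log k)^{1/p} / k^{(p−1)/p}) [ (5/9) ‖x_1 − x*‖²/γ + (6/5) v_p ‖x_1 − x*‖ + (3/4) γ (1+log(1+log k))² (v_p + √(w_p))² ]. -/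
open MeasureTheory Real
open scoped RealInnerProductSpace

theorem norm_nearest_sub_le {H : Type*} [NormedAddCommGroup H] [InnerProductSpace ℝ H]
    {X : Set H} (hX : Convex ℝ X) {a b y : H} (ha : a ∈ X) (hy : y ∈ X)
    (hmin : ∀ w ∈ X, ‖a - b‖ ≤ ‖w - b‖) : ‖a - y‖ ≤ ‖b - y‖ := by
  have hinf : ‖b - a‖ = ⨅ w : X, ‖b - w‖ := by
    have : Nonempty X := ⟨⟨a, ha⟩⟩
    refine le_antisymm (le_ciInf fun w => ?_) (ciInf_le ⟨0, ?_⟩ (⟨a, ha⟩ : X))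
    · rw [norm_sub_rev b a, norm_sub_rev b w]
      exact hmin w w.2
    · rintro _ ⟨w, rfl⟩
      exact norm_nonneg _
  have hinner := (norm_eq_iInf_iff_real_inner_le_zero hX ha).1 hinf y hy
  have hexp : ‖b - y‖ ^ 2 = ‖b - a‖ ^ 2 - 2 * ⟪b - a, y - a⟫ + ‖y - a‖ ^ 2 := by
    rw [← norm_sub_sq_real]
    congr 2
    abel
  rw [norm_sub_rev a y]
  refine le_of_sq_le_sq ?_ (norm_nonneg _)
  nlinarith [sq_nonneg ‖b - a‖]

theorem integral_norm_le_sqrt {H Ω : Type*} [NormedAddCommGroup H] [MeasurableSpace Ω]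
    {μ : Measure Ω} [IsProbabilityMeasure μ] {g : Ω → H} (hg : MemLp g 2 μ) :
    ∫ ω, ‖g ω‖ ∂μ ≤ √(∫ ω, ‖g ω‖ ^ 2 ∂μ) := by
  have hsq : Integrable (fun ω => ‖g ω‖ ^ 2) μ := hg.integrable_norm_pow two_ne_zero
  have h1 : Integrable (fun ω => ‖g ω‖) μ := (hg.integrable one_le_two).norm
  refine Real.le_sqrt_of_sq_le ?_
  exact (convexOn_pow 2).map_integral_le (continuous_pow 2).continuousOn isClosed_Ici
    (ae_of_all _ fun ω => norm_nonneg (g ω)) h1 hsq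

theorem LipschitzWith.integrable_comp_of_integrable {H Ω : Type*} [NormedAddCommGroup H]
    [MeasurableSpace Ω] {μ : Measure Ω} [IsFiniteMeasure μ] {K : NNReal} {f : H → ℝ}
    (hf : LipschitzWith K f) {g : Ω → H} (hg : Integrable g μ) :
    Integrable (fun ω => f (g ω)) μ := by
  refine ((integrable_const ‖f 0‖).add (hg.norm.const_mul (K : ℝ))).mono'
    (hf.continuous.comp_aestronglyMeasurable hg.aestronglyMeasurable) (ae_of_all _ fun ω => ?_)
  have h := hf.norm_sub_le (g ω) 0
  rw [sub_zero] at h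
  have := norm_le_norm_add_norm_sub' (f (g ω)) (f 0)
  simp only [Pi.add_apply]
  linarith

theorem integral_norm_sq_projected_step_le {H Ω : Type*} [NormedAddCommGroup H]
    [InnerProductSpace ℝ H] [CompleteSpace H] {m mΩ : MeasurableSpace Ω} (hm : m ≤ mΩ)
    {μ : Measure Ω} [IsProbabilityMeasure μ] {K : NNReal} {f : H → ℝ} (hf : LipschitzWith K f)
    {a a' y g u : Ω → H} {η β M c : ℝ} (hη : 0 ≤ η) (hβ : 0 ≤ β)
    (ham : StronglyMeasurable[m] a) (hym : StronglyMeasurable[m] y)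
    (ha : MemLp a 2 μ) (hy : MemLp y 2 μ) (ha' : MemLp a' 2 μ)
    (hgm : AEStronglyMeasurable g μ) (hgc : ∀ᵐ ω ∂μ, ‖g ω‖ ≤ c)
    (hsub : ∀ᵐ ω ∂μ, f (a ω) + ⟪u ω, y ω - a ω⟫ ≤ f (y ω))
    (hbias : ∀ᵐ ω ∂μ, ‖(μ[g | m]) ω - u ω‖ ≤ β)
    (hmom : ∀ᵐ ω ∂μ, (μ[(fun ω' => ‖g ω'‖ ^ 2) | m]) ω ≤ M)
    (hstep : ∀ ω, ‖a' ω - y ω‖ ≤ ‖a ω - η • g ω - y ω‖) :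
    ∫ ω, ‖a' ω - y ω‖ ^ 2 ∂μ ≤ ∫ ω, ‖a ω - y ω‖ ^ 2 ∂μ
      - 2 * η * (∫ ω, f (a ω) ∂μ - ∫ ω, f (y ω) ∂μ)
      + 2 * η * β * √(∫ ω, ‖a ω - y ω‖ ^ 2 ∂μ) + η ^ 2 * M := by
  have hg : MemLp g 2 μ := MemLp.of_bound hgm c hgc
  have hd : MemLp (fun ω => a ω - y ω) 2 μ := ha.sub hy
  have hd2 : Integrable (fun ω => ‖a ω - y ω‖ ^ 2) μ := hd.integrable_norm_pow two_ne_zero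
  have hg2 : Integrable (fun ω => ‖g ω‖ ^ 2) μ := hg.integrable_norm_pow two_ne_zero
  have hi : Integrable (fun ω => ⟪g ω, a ω - y ω⟫) μ := by
    refine ((hd.integrable one_le_two).norm.const_mul c).mono'
      (hgm.inner hd.aestronglyMeasurable) ?_
    filter_upwards [hgc] with ω hω
    exact (norm_inner_le_norm _ _).trans (mul_le_mul_of_nonneg_right hω (norm_nonneg _))
  have hfa := hf.integrable_comp_of_integrable (ha.integrable one_le_two)
  have hfy := hf.integrable_comp_of_integrable (hy.integrable one_le_two)
  have hpull : μ[fun ω => ⟪g ω, a ω - y ω⟫ | m] =ᵐ[μ] fun ω => ⟪(μ[g | m]) ω, a ω - y ω⟫ :=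
    condExp_bilin_of_stronglyMeasurable_right (innerSL ℝ) (ham.sub hym) hi
      (hg.integrable one_le_two)
  have hinner : ∫ ω, f (a ω) ∂μ - ∫ ω, f (y ω) ∂μ - β * √(∫ ω, ‖a ω - y ω‖ ^ 2 ∂μ)
      ≤ ∫ ω, ⟪g ω, a ω - y ω⟫ ∂μ := by
    calc _ ≤ ∫ ω, f (a ω) ∂μ - ∫ ω, f (y ω) ∂μ - β * ∫ ω, ‖a ω - y ω‖ ∂μ := by
          gcongr
          exact integral_norm_le_sqrt hd
      _ = ∫ ω, (f (a ω) - f (y ω) - β * ‖a ω - y ω‖) ∂μ := by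
          have hn : Integrable (fun ω => β * ‖a ω - y ω‖) μ :=
            (hd.integrable one_le_two).norm.const_mul β
          have hab : Integrable (fun ω => f (a ω) - f (y ω)) μ := hfa.sub hfy
          rw [integral_sub hab hn, integral_sub hfa hfy, integral_const_mul]
      _ ≤ ∫ ω, (μ[fun ω => ⟪g ω, a ω - y ω⟫ | m]) ω ∂μ := by
          refine integral_mono_ae ((hfa.sub hfy).sub
            ((hd.integrable one_le_two).norm.const_mul β)) integrable_condExp ?_
          filter_upwards [hpull, hsub, hbias] with ω h1 h2 h3
          rw [h1]
          have h4 : ⟪(μ[g | m]) ω, a ω - y ω⟫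
              = -⟪u ω, y ω - a ω⟫ + ⟪(μ[g | m]) ω - u ω, a ω - y ω⟫ := by
            rw [inner_sub_left, ← neg_sub (a ω) (y ω), inner_neg_right]
            ring
          have h5 := (abs_le.1 (abs_real_inner_le_norm ((μ[g | m]) ω - u ω) (a ω - y ω))).1
          have h6 := mul_le_mul_of_nonneg_right h3 (norm_nonneg (a ω - y ω))
          linarith
      _ = _ := integral_condExp hm
  have hmoment : ∫ ω, ‖g ω‖ ^ 2 ∂μ ≤ M := by
    rw [← integral_condExp hm]
    refine (integral_mono_ae integrable_condExp (integrable_const M) hmom).trans ?_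
    simp
  have hexpand : ∫ ω, ‖a' ω - y ω‖ ^ 2 ∂μ ≤ ∫ ω, ‖a ω - y ω‖ ^ 2 ∂μ
      - 2 * η * ∫ ω, ⟪g ω, a ω - y ω⟫ ∂μ + η ^ 2 * ∫ ω, ‖g ω‖ ^ 2 ∂μ := by
    have hcross : Integrable
        (fun ω => ‖a ω - y ω‖ ^ 2 - 2 * η * ⟪g ω, a ω - y ω⟫) μ :=
      hd2.sub (hi.const_mul _)
    rw [← integral_const_mul, ← integral_const_mul, ← integral_sub hd2 (hi.const_mul _),
      ← integral_add hcross (hg2.const_mul _)]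
    refine integral_mono ((ha'.sub hy).integrable_norm_pow two_ne_zero)
      (hcross.add (hg2.const_mul _)) fun ω => ?_
    have h1 : ‖a ω - η • g ω - y ω‖ ^ 2
        = ‖a ω - y ω‖ ^ 2 - 2 * η * ⟪g ω, a ω - y ω⟫ + η ^ 2 * ‖g ω‖ ^ 2 := by
      rw [sub_right_comm, norm_sub_sq_real, inner_smul_right, norm_smul, real_inner_comm,
        mul_pow, Real.norm_eq_abs, sq_abs]
      ring
    have h2 := pow_le_pow_left₀ (norm_nonneg _) (hstep ω) 2
    simpa only [h1] using h2
  nlinarith [mul_le_mul_of_nonneg_left hinner hη, mul_le_mul_of_nonneg_left hmoment (sq_nonneg η)]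

theorem sum_inv_mul_one_add_log_le (n : ℕ) :
    ∑ i ∈ Finset.range (n + 1), 1 / (((i : ℝ) + 1) * (1 + log ((i : ℝ) + 1)))
      ≤ 1 + log (1 + log ((n : ℝ) + 1)) := by
  induction n with
  | zero => simp
  | succ n ih =>
    rw [Finset.sum_range_succ]
    push_cast
    have hn : (0 : ℝ) ≤ n := n.cast_nonneg
    set a := (n : ℝ) + 1 with ha
    have ha1 : 1 ≤ a := by linarith
    have hla : 0 ≤ log a := log_nonneg ha1
    have hlb : 0 ≤ log (a + 1) := log_nonneg (by linarith)
    have h1 : 1 / (a + 1) ≤ log (a + 1) - log a := by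
      rw [← log_div (by positivity) (by positivity)]
      refine le_trans (le_of_eq ?_) (one_sub_inv_le_log_of_pos (by positivity))
      field_simp
      ring
    have h2 : (log (a + 1) - log a) / (1 + log (a + 1))
        ≤ log (1 + log (a + 1)) - log (1 + log a) := by
      have hpa : 0 < 1 + log a := by linarith
      have hpb : 0 < 1 + log (a + 1) := by linarith
      rw [← log_div hpb.ne' hpa.ne']
      refine le_trans (le_of_eq ?_) (one_sub_inv_le_log_of_pos (by positivity))
      field_simp
      ring
    have h3 : 1 / ((a + 1) * (1 + log (a + 1)))
        ≤ (log (a + 1) - log a) / (1 + log (a + 1)) := by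
      rw [← div_div]
      gcongr
    linarith

theorem sum_one_div_sub_le (n : ℕ) :
    ∑ i ∈ Finset.range n, 1 / ((n : ℝ) - i) ≤ log ((n : ℝ) + 1) + 1 - 1 / ((n : ℝ) + 1) := by
  have hr : ∑ i ∈ Finset.range n, 1 / ((n : ℝ) - i) = (harmonic n : ℝ) := by
    rw [← Finset.sum_range_reflect]
    simp only [harmonic, Rat.cast_sum]
    refine Finset.sum_congr rfl fun i hi => ?_
    have hi' := Finset.mem_range.1 hi
    rw [Nat.sub_sub, Nat.cast_sub (by omega)]
    push_cast
    rw [one_div]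
    congr 1
    ring
  have h := harmonic_le_one_add_log (n + 1)
  rw [harmonic_succ] at h
  push_cast at h
  rw [hr, one_div]
  linarith

theorem sum_weighted_schedule_le (n : ℕ) :
    ((n : ℝ) + 1) * (∑ i ∈ Finset.range n,
        1 / (((i : ℝ) + 1) * (1 + log ((i : ℝ) + 1))) / ((n : ℝ) - i)
        + 1 / (((n : ℝ) + 1) * (1 + log ((n : ℝ) + 1))))
      ≤ ∑ i ∈ Finset.range n, 1 / (((i : ℝ) + 1) * (1 + log ((i : ℝ) + 1)))
        + (∑ i ∈ Finset.range n, 1 / ((n : ℝ) - i) + 1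
          + ∑ i ∈ Finset.range n, 1 / (((i : ℝ) + 1) * (1 + log ((i : ℝ) + 1))))
          / (1 + log ((n : ℝ) + 1)) := by
  have hl : 0 ≤ log ((n : ℝ) + 1) := log_nonneg (by linarith [n.cast_nonneg (α := ℝ)])
  have hterm : ∀ i ∈ Finset.range n,
      ((n : ℝ) + 1) * (1 / (((i : ℝ) + 1) * (1 + log ((i : ℝ) + 1))) / ((n : ℝ) - i))
      ≤ 1 / (((i : ℝ) + 1) * (1 + log ((i : ℝ) + 1)))
        + (1 / ((n : ℝ) - i) + 1 / (((i : ℝ) + 1) * (1 + log ((i : ℝ) + 1))))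
          / (1 + log ((n : ℝ) + 1)) := by
    intro i hi
    have hin : (i : ℝ) < n := by exact_mod_cast Finset.mem_range.1 hi
    have hi0 : (0 : ℝ) ≤ i := i.cast_nonneg
    obtain ⟨d, hd⟩ : ∃ d, d = (n : ℝ) - i := ⟨_, rfl⟩
    have hdpos : 0 < d := by linarith
    have hli : 0 ≤ log ((i : ℝ) + 1) := log_nonneg (by linarith)
    have hlog : log ((n : ℝ) + 1) - log ((i : ℝ) + 1) ≤ d / ((i : ℝ) + 1) := by
      rw [← log_div (by positivity) (by positivity)]
      refine (log_le_sub_one_of_pos (by positivity)).trans (le_of_eq ?_)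
      rw [hd]
      field_simp
      ring
    have hnd : (n : ℝ) + 1 = d + (i + 1) := by rw [hd]; ring
    rw [hnd] at hlog hl
    rw [← hd, hnd]
    set t := (i : ℝ) + 1
    have ht : 0 < t := by positivity
    set A := log t
    set B := log (d + t)
    rw [le_div_iff₀ ht] at hlog
    have key : 1 / (t * (1 + A)) + (1 / d + 1 / (t * (1 + A))) / (1 + B)
        - (d + t) * (1 / (t * (1 + A)) / d)
        = (d - (B - A) * t) / (d * t * (1 + A) * (1 + B)) := by
      field_simp
      ring
    have : 0 ≤ (d - (B - A) * t) / (d * t * (1 + A) * (1 + B)) :=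
      div_nonneg (by linarith) (by positivity)
    linarith
  have hlast : ((n : ℝ) + 1) * (1 / (((n : ℝ) + 1) * (1 + log ((n : ℝ) + 1))))
      = 1 / (1 + log ((n : ℝ) + 1)) := by
    field_simp
  have hs := Finset.sum_le_sum hterm
  rw [← Finset.mul_sum, Finset.sum_add_distrib, ← Finset.sum_div, Finset.sum_add_distrib] at hs
  rw [mul_add, hlast]
  refine (add_le_add_left hs _).trans (le_of_eq ?_)
  ring

theorem sum_weighted_schedule_le_log (n : ℕ) :
    ((n : ℝ) + 1) * (∑ i ∈ Finset.range n,
        1 / (((i : ℝ) + 1) * (1 + log ((i : ℝ) + 1))) / ((n : ℝ) - i)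
        + 1 / (((n : ℝ) + 1) * (1 + log ((n : ℝ) + 1))))
      ≤ min (12 / 5 * (1 + log (1 + log ((n : ℝ) + 1))))
        (3 / 2 * (1 + log (1 + log ((n : ℝ) + 1))) ^ 2) := by
  rcases n with _ | _ | n
  · norm_num
  · refine (sum_weighted_schedule_le 1).trans ?_
    norm_num [Finset.sum_range_one]
    have h2 := Real.log_two_gt_d9
    have hl : 1 - (1 + log 2)⁻¹ ≤ log (1 + log 2) :=
      one_sub_inv_le_log_of_pos (by linarith)
    have hinv : (1 + log 2)⁻¹ ≤ 3 / 5 := by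
      rw [inv_le_comm₀ (by linarith) (by norm_num)]
      linarith
    rw [div_eq_mul_inv]
    constructor <;> nlinarith
  · refine (sum_weighted_schedule_le (n + 2)).trans ?_
    have hn : (0 : ℝ) ≤ n := n.cast_nonneg
    have hsum := sum_inv_mul_one_add_log_le (n + 2)
    rw [Finset.sum_range_succ] at hsum
    have hharm := sum_one_div_sub_le (n + 2)
    set s := ∑ i ∈ Finset.range (n + 2), 1 / (((i : ℝ) + 1) * (1 + log ((i : ℝ) + 1)))
    set h := ∑ i ∈ Finset.range (n + 2), 1 / (((n + 2 : ℕ) : ℝ) - i)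
    push_cast at *
    rw [show (n : ℝ) + 1 + 1 = n + 2 by ring]
    have hl1 : 1 ≤ log ((n : ℝ) + 2 + 1) := by
      rw [le_log_iff_exp_le (by positivity)]
      linarith [Real.exp_one_lt_d9]
    set l := log ((n : ℝ) + 2 + 1)
    have hS : log 2 ≤ log (1 + l) := log_le_log (by norm_num) (by linarith)
    have h2 := Real.log_two_gt_d9
    have hpos : 0 < 1 / (((n : ℝ) + 2 + 1) * (1 + l)) := by positivity
    have hpos' : 0 < 1 / ((n : ℝ) + 2 + 1) := by positivity
    set S := 1 + log (1 + l)
    have hs : s ≤ S := by linarith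
    have hfrac : (h + 1 + s) / (1 + l) ≤ 1 + (1 + S) / 2 := by
      rw [div_le_iff₀ (by linarith)]
      nlinarith
    refine le_min ?_ ?_ <;> nlinarith

theorem le_sq_sqrt_add_of_le {E B b c r r' : ℝ} (hE : 0 ≤ E) (hB : 0 ≤ B) (hb : 0 ≤ b)
    (hc : 0 ≤ c) (hr : r ≤ (√E + B) ^ 2) (hr' : r' ≤ r + 2 * b * √r + c) :
    r' ≤ (√(E + c) + (B + b)) ^ 2 := by
  have hsr : √r ≤ √E + B := (Real.sqrt_le_sqrt hr).trans_eq (Real.sqrt_sq (by positivity))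
  have hmono : √E ≤ √(E + c) := Real.sqrt_le_sqrt (by linarith)
  nlinarith [Real.sq_sqrt hE, Real.sq_sqrt (add_nonneg hE hc),
    mul_le_mul_of_nonneg_left hsr hb, mul_le_mul_of_nonneg_left hmono (add_nonneg hB hb),
    sq_nonneg b]

theorem potential_step {q ψ ψ' γ F F' δ b c : ℝ} (hq : 0 < q) (hψ : 0 ≤ ψ) (hγ : 0 ≤ γ)
    (hF : 0 ≤ F) (hb : 0 ≤ b) (hF' : (q + 1) * F' ≤ q * F + δ)
    (hψ' : ψ' ≤ (q / (q + 1)) ^ 2 * ψ - 2 * γ * (δ - F') + 2 * b * (q / (q + 1) * √ψ) + c) :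
    ψ' / q + 2 * γ * F' ≤ (ψ / (q + 1) + 2 * γ * F)
      + 2 * (b / √(q + 1)) * √(ψ / (q + 1) + 2 * γ * F) + c / q := by
  have hgap : q * (F' - F) ≤ δ - F' := by linarith
  have hq1 : 0 < √(q + 1) := Real.sqrt_pos.2 (by linarith)
  have hdiv : ψ' / q ≤ q / (q + 1) * (ψ / (q + 1)) - 2 * γ * (F' - F)
      + 2 * (b / (q + 1) * √ψ) + c / q := by
    rw [div_le_iff₀ hq]
    have h : (q / (q + 1) * (ψ / (q + 1)) - 2 * γ * (F' - F) + 2 * (b / (q + 1) * √ψ) + c / q) * q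
        = (q / (q + 1)) ^ 2 * ψ - 2 * γ * (q * (F' - F)) + 2 * b * (q / (q + 1) * √ψ) + c := by
      field_simp
    rw [h]
    nlinarith [mul_le_mul_of_nonneg_left hgap hγ]
  have hψq : 0 ≤ ψ / (q + 1) := by positivity
  have hcontr : q / (q + 1) * (ψ / (q + 1)) ≤ ψ / (q + 1) :=
    mul_le_of_le_one_left hψq ((div_le_one (by linarith)).2 (by linarith))
  have hsqrt : b / (q + 1) * √ψ ≤ b / √(q + 1) * √(ψ / (q + 1) + 2 * γ * F) := by
    calc b / (q + 1) * √ψ = b / √(q + 1) * √(ψ / (q + 1)) := by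
          rw [Real.sqrt_div' _ (by linarith : 0 ≤ q + 1), div_mul_div_comm,
            Real.mul_self_sqrt (by linarith), div_mul_eq_mul_div]
      _ ≤ _ := by
          gcongr
          have : 0 ≤ 2 * γ * F := by positivity
          linarith
  linarith

/-- Comparison points for the last-iterate analysis at horizon `n`: convex combinations of `y` and
the iterates, which absorb `x i` with weight `1 / (n - i + 1)`. -/
noncomputable def comparisonPoint {H Ω : Type*} [NormedAddCommGroup H] [InnerProductSpace ℝ H]
    (n : ℕ) (x : ℕ → Ω → H) (y : H) : ℕ → Ω → H
  | 0 => fun _ => y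
  | i + 1 => fun ω => (((n : ℝ) - i) / ((n : ℝ) - i + 1)) • comparisonPoint n x y i ω
      + (1 / ((n : ℝ) - i + 1)) • x i ω

section LastIterate

variable {H : Type*} [NormedAddCommGroup H] [InnerProductSpace ℝ H]
  {Ω : Type*} {mΩ : MeasurableSpace Ω}

theorem comparisonPoint_mem {X : Set H} (hX : Convex ℝ X) {x : ℕ → Ω → H}
    (hx : ∀ i ω, x i ω ∈ X) {y : H} (hy : y ∈ X) {n i : ℕ} (hi : i ≤ n) (ω : Ω) :
    comparisonPoint n x y i ω ∈ X := by
  induction i with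
  | zero => exact hy
  | succ i ih =>
    have hin : (i : ℝ) + 1 ≤ n := by exact_mod_cast hi
    refine hX (ih (by omega)) (hx i ω) (div_nonneg (by linarith) (by linarith))
      (one_div_nonneg.2 (by linarith)) ?_
    rw [← add_div]
    exact div_self (by linarith)

theorem comparisonPoint_memLp {μ : Measure Ω} [IsFiniteMeasure μ] {x : ℕ → Ω → H}
    (hx : ∀ i, MemLp (x i) 2 μ) (y : H) (n i : ℕ) : MemLp (comparisonPoint n x y i) 2 μ := by
  induction i with
  | zero => exact memLp_const y
  | succ i ih => exact (ih.const_smul _).add ((hx i).const_smul _)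

theorem comparisonPoint_stronglyMeasurable {ℱ : ℕ → MeasurableSpace Ω} (hℱ : Monotone ℱ)
    {x : ℕ → Ω → H} (hx : ∀ i, StronglyMeasurable[ℱ i] (x i)) (y : H) (n : ℕ) {i j : ℕ}
    (hij : i ≤ j + 1) : StronglyMeasurable[ℱ j] (comparisonPoint n x y i) := by
  induction i with
  | zero => exact stronglyMeasurable_const
  | succ i ih =>
    exact ((ih (by omega)).const_smul _).add (((hx i).mono (hℱ (by omega))).const_smul _)

theorem sub_comparisonPoint_succ (x : ℕ → Ω → H) (y : H) {n i : ℕ} (hi : i < n) (ω : Ω) :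
    x i ω - comparisonPoint n x y (i + 1) ω
      = (((n : ℝ) - i) / ((n : ℝ) - i + 1)) • (x i ω - comparisonPoint n x y i ω) := by
  have hin : (i : ℝ) < n := by exact_mod_cast hi
  have hq : (n : ℝ) - i + 1 ≠ 0 := by linarith
  have h1 : (1 : ℝ) / ((n : ℝ) - i + 1) = 1 - ((n : ℝ) - i) / ((n : ℝ) - i + 1) := by
    field_simp
    ring
  simp only [comparisonPoint]
  rw [h1]
  module

theorem last_iterate_le {μ : Measure Ω} [IsProbabilityMeasure μ] {X : Set H} (hX : Convex ℝ X)
    {K : NNReal} {f : H → ℝ} (hfcv : ConvexOn ℝ Set.univ f) (hf : LipschitzWith K f)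
    {xstar : H} (hxs : xstar ∈ X) (hmin : ∀ y ∈ X, f xstar ≤ f y)
    {ℱ : ℕ → MeasurableSpace Ω} (hℱ : Monotone ℱ) {x : ℕ → Ω → H}
    (hxm : ∀ i, StronglyMeasurable[ℱ i] (x i)) (hxX : ∀ i ω, x i ω ∈ X)
    (hxL : ∀ i, MemLp (x i) 2 μ) {γ b c : ℕ → ℝ} (hγ : ∀ i, 0 ≤ γ i) (hγanti : Antitone γ)
    (hb : ∀ i, 0 ≤ b i) (hc : ∀ i, 0 ≤ c i)
    (hstep : ∀ i, ∀ y : Ω → H, StronglyMeasurable[ℱ i] y → MemLp y 2 μ → (∀ ω, y ω ∈ X) →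
      ∫ ω, ‖x (i + 1) ω - y ω‖ ^ 2 ∂μ ≤ ∫ ω, ‖x i ω - y ω‖ ^ 2 ∂μ
        - 2 * γ i * (∫ ω, f (x i ω) ∂μ - ∫ ω, f (y ω) ∂μ)
        + 2 * b i * √(∫ ω, ‖x i ω - y ω‖ ^ 2 ∂μ) + c i) (n : ℕ) :
    2 * γ n * (∫ ω, f (x n ω) ∂μ - f xstar) ≤
      (√((∫ ω, ‖x 0 ω - xstar‖ ^ 2 ∂μ) / ((n : ℝ) + 1)
          + ∑ i ∈ Finset.range n, c i / ((n : ℝ) - i) + c n)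
        + ∑ i ∈ Finset.range (n + 1), b i / √((n : ℝ) - i + 1)) ^ 2 := by
  set z := comparisonPoint n x xstar with hz
  have hzX : ∀ {i}, i ≤ n → ∀ ω, z i ω ∈ X := fun hi => comparisonPoint_mem hX hxX hxs hi
  have hzL : ∀ i, MemLp (z i) 2 μ := comparisonPoint_memLp hxL xstar n
  have hfz : ∀ i, Integrable (fun ω => f (z i ω)) μ := fun i =>
    hf.integrable_comp_of_integrable ((hzL i).integrable one_le_two)
  have hfx : ∀ i, Integrable (fun ω => f (x i ω)) μ := fun i =>
    hf.integrable_comp_of_integrable ((hxL i).integrable one_le_two)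
  set ψ : ℕ → ℝ := fun i => ∫ ω, ‖x i ω - z i ω‖ ^ 2 ∂μ with hψdef
  set F : ℕ → ℝ := fun i => ∫ ω, f (z i ω) ∂μ - f xstar with hFdef
  have hψ : ∀ i, 0 ≤ ψ i := fun i => integral_nonneg fun ω => sq_nonneg _
  have hF : ∀ {i}, i ≤ n → 0 ≤ F i := by
    intro i hi
    have := integral_mono (integrable_const (f xstar)) (hfz i) fun ω => hmin _ (hzX hi ω)
    simpa [hFdef] using this
  have hF0 : F 0 = 0 := by simp [hFdef, hz, comparisonPoint]
  set D := ∫ ω, ‖x 0 ω - xstar‖ ^ 2 ∂μ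
  have hD : 0 ≤ D := integral_nonneg fun ω => sq_nonneg _
  have hC : ∀ {i}, i ≤ n → 0 ≤ D / ((n : ℝ) + 1) + ∑ j ∈ Finset.range i, c j / ((n : ℝ) - j) := by
    intro i hi
    refine add_nonneg (by positivity) (Finset.sum_nonneg fun j hj => div_nonneg (hc j) ?_)
    have : (j : ℝ) ≤ n := by exact_mod_cast (Finset.mem_range.1 hj).le.trans hi
    linarith
  have hB : ∀ i, 0 ≤ ∑ j ∈ Finset.range i, b j / √((n : ℝ) - j + 1) := fun i =>
    Finset.sum_nonneg fun j _ => div_nonneg (hb j) (Real.sqrt_nonneg _)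
  have hpot : ∀ i, i ≤ n → ψ i / ((n : ℝ) - i + 1) + 2 * γ i * F i ≤
      (√(D / ((n : ℝ) + 1) + ∑ j ∈ Finset.range i, c j / ((n : ℝ) - j))
        + ∑ j ∈ Finset.range i, b j / √((n : ℝ) - j + 1)) ^ 2 := by
    intro i
    induction i with
    | zero =>
      intro _
      rw [hF0, Finset.sum_range_zero, Finset.sum_range_zero, add_zero, add_zero,
        Real.sq_sqrt (by positivity)]
      simp [hψdef, hz, comparisonPoint, D]
    | succ i ih =>
      intro hi
      have hin : (i : ℝ) + 1 ≤ n := by exact_mod_cast hi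
      have hq : 0 < (n : ℝ) - i := by linarith
      rw [Finset.sum_range_succ, Finset.sum_range_succ, ← add_assoc (D / _)]
      refine le_sq_sqrt_add_of_le (hC (by omega)) (hB i) (div_nonneg (hb i) (Real.sqrt_nonneg _))
        (div_nonneg (hc i) hq.le) (ih (by omega)) ?_
      have hstep' := hstep i (z (i + 1))
        (comparisonPoint_stronglyMeasurable hℱ hxm xstar n le_rfl) (hzL _) (hzX hi)
      have hnorm : ∫ ω, ‖x i ω - z (i + 1) ω‖ ^ 2 ∂μ
          = (((n : ℝ) - i) / ((n : ℝ) - i + 1)) ^ 2 * ψ i := by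
        rw [hψdef, ← integral_const_mul]
        refine integral_congr_ae (ae_of_all _ fun ω => ?_)
        simp only [hz]
        rw [sub_comparisonPoint_succ x xstar (by omega) ω, norm_smul, mul_pow, Real.norm_eq_abs,
          sq_abs]
      rw [hnorm, Real.sqrt_mul (sq_nonneg _), Real.sqrt_sq (by positivity)] at hstep'
      have hconv : ((n : ℝ) - i + 1) * F (i + 1)
          ≤ ((n : ℝ) - i) * F i + (∫ ω, f (x i ω) ∂μ - f xstar) := by
        have hpt : ∫ ω, f (z (i + 1) ω) ∂μ ≤ ((n : ℝ) - i) / ((n : ℝ) - i + 1) * ∫ ω, f (z i ω) ∂μ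
            + 1 / ((n : ℝ) - i + 1) * ∫ ω, f (x i ω) ∂μ := by
          rw [← integral_const_mul, ← integral_const_mul,
            ← integral_add ((hfz i).const_mul _) ((hfx i).const_mul _)]
          refine integral_mono (hfz _) (((hfz i).const_mul _).add ((hfx i).const_mul _)) fun ω => ?_
          refine hfcv.2 (Set.mem_univ _) (Set.mem_univ _) (by positivity) (by positivity) ?_
          rw [← add_div]
          exact div_self (by positivity)
        have hmul := mul_le_mul_of_nonneg_left hpt (by positivity : 0 ≤ (n : ℝ) - i + 1)
        have heq : ((n : ℝ) - i + 1) * (((n : ℝ) - i) / ((n : ℝ) - i + 1) * ∫ ω, f (z i ω) ∂μ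
            + 1 / ((n : ℝ) - i + 1) * ∫ ω, f (x i ω) ∂μ)
            = ((n : ℝ) - i) * ∫ ω, f (z i ω) ∂μ + ∫ ω, f (x i ω) ∂μ := by
          field_simp
        simp only [hFdef]
        linarith
      have hmain := potential_step (ψ' := ψ (i + 1)) (c := c i) hq (hψ i) (hγ i) (hF (by omega))
        (hb i) hconv (by
          rw [sub_sub_sub_cancel_right]
          exact hstep')
      have hγF := mul_le_mul_of_nonneg_right (hγanti i.le_succ) (hF hi)
      have hcast : (n : ℝ) - (i + 1 : ℕ) + 1 = n - i := by
        push_cast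
        ring
      rw [hcast]
      linarith
  have hn : (n : ℝ) - n + 1 = 1 := by ring
  have hfin := hstep n (z n) (comparisonPoint_stronglyMeasurable hℱ hxm xstar n n.le_succ) (hzL n)
    (hzX le_rfl)
  rw [Finset.sum_range_succ (fun i => b i / √((n : ℝ) - i + 1)), hn, Real.sqrt_one, div_one]
  refine le_sq_sqrt_add_of_le (hC le_rfl) (hB n) (hb n) (hc n) (hpot n le_rfl) ?_
  rw [hn, div_one]
  have hnext : 0 ≤ ∫ ω, ‖x (n + 1) ω - z n ω‖ ^ 2 ∂μ := integral_nonneg fun ω => sq_nonneg _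
  have hle : √(ψ n) ≤ √(ψ n + 2 * γ n * F n) :=
    Real.sqrt_le_sqrt (by nlinarith [mul_nonneg (hγ n) (hF le_rfl)])
  have := mul_le_mul_of_nonneg_left hle (hb n)
  simp only [hψdef, hFdef] at *
  linarith

end LastIterate

theorem half_sq_le_anytime_bound {D γ v w m k S : ℝ} (hD : 0 ≤ D) (hγ : 0 ≤ γ) (hv : 0 ≤ v)
    (hw : 0 ≤ w) (hm : 0 ≤ m) (hk : 0 ≤ k) (hS : 0 ≤ S) (hmS : m ≤ 12 / 5 * S)
    (hmS2 : m ≤ 3 / 2 * S ^ 2) (hkm : k ^ 2 ≤ S * m) :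
    (√(D ^ 2 + γ ^ 2 * w * m) + γ * (v / 4) * k) ^ 2 / 2 ≤
      5 / 9 * D ^ 2 + 6 / 5 * v * D * γ + 3 / 4 * γ ^ 2 * S ^ 2 * (v + √w) ^ 2 := by
  have hk2 : k ^ 2 ≤ 12 / 5 * S ^ 2 := by nlinarith
  have hkle : k ≤ 2 * S := le_of_sq_le_sq (by nlinarith [sq_nonneg S]) (by linarith)
  have hMle : √m ≤ 2 * S := Real.sqrt_le_iff.2 ⟨by linarith, by nlinarith [sq_nonneg S]⟩
  have hkM : k * √m ≤ 4 * S ^ 2 := by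
    nlinarith [mul_le_mul hkle hMle (Real.sqrt_nonneg m) (by linarith)]
  have hW := Real.sqrt_nonneg w
  have hR : √(D ^ 2 + γ ^ 2 * w * m) ≤ D + γ * √w * √m := by
    refine Real.sqrt_le_iff.2 ⟨by positivity, ?_⟩
    have h1 : (γ * √w * √m) ^ 2 = γ ^ 2 * w * m := by
      rw [mul_pow, mul_pow, Real.sq_sqrt hw, Real.sq_sqrt hm]
    nlinarith [mul_nonneg hD (by positivity : 0 ≤ γ * √w * √m)]
  have hRsq : √(D ^ 2 + γ ^ 2 * w * m) ^ 2 ≤ D ^ 2 + γ ^ 2 * w * (3 / 2 * S ^ 2) := by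
    rw [Real.sq_sqrt (by positivity)]
    gcongr
  have hcross : √(D ^ 2 + γ ^ 2 * w * m) * (γ * v * k)
      ≤ D * (γ * v * k) + γ ^ 2 * (v * √w) * (4 * S ^ 2) := by
    calc _ ≤ (D + γ * √w * √m) * (γ * v * k) := by gcongr
      _ = D * (γ * v * k) + γ ^ 2 * (v * √w) * (k * √m) := by ring
      _ ≤ _ := by gcongr
  have hamgm : D * (γ * v * k) / 4 ≤ D ^ 2 / 18 + 9 / 32 * (γ * v * k) ^ 2 := by
    nlinarith [sq_nonneg (D / 3 - 3 / 4 * (γ * v * k))]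
  have hv2 : (γ * v * k) ^ 2 ≤ 12 / 5 * (γ ^ 2 * S ^ 2 * v ^ 2) := by
    have := mul_le_mul_of_nonneg_left hk2 (by positivity : 0 ≤ γ ^ 2 * v ^ 2)
    nlinarith
  have hvD : 0 ≤ v * D * γ := by positivity
  have hvw : 0 ≤ γ ^ 2 * (v * √w) * S ^ 2 := by positivity
  have hexp : (v + √w) ^ 2 = v ^ 2 + 2 * (v * √w) + w := by
    rw [add_sq, Real.sq_sqrt hw]
    ring
  rw [hexp]
  linarith

theorem sq_sum_schedule_le {s : ℕ → ℝ} (hs : ∀ i, 0 ≤ s i) (n : ℕ) :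
    (∑ i ∈ Finset.range (n + 1), s i / √((n : ℝ) - i + 1)) ^ 2 ≤
      (∑ i ∈ Finset.range (n + 1), s i) * (∑ i ∈ Finset.range n, s i / ((n : ℝ) - i) + s n) := by
  have hle : ∀ {i}, i ∈ Finset.range (n + 1) → (i : ℝ) ≤ n := fun hi => by
    exact_mod_cast Nat.lt_succ_iff.1 (Finset.mem_range.1 hi)
  refine (Finset.sum_sq_le_sum_mul_sum_of_sq_le_mul (Finset.range (n + 1)) (f := s)
    (g := fun i => s i / ((n : ℝ) - i + 1)) (fun i _ => hs i)
    (fun i hi => div_nonneg (hs i) (by linarith [hle hi])) fun i hi => ?_).trans ?_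
  · rw [div_pow, Real.sq_sqrt (by linarith [hle hi])]
    exact le_of_eq (by ring)
  · refine mul_le_mul_of_nonneg_left ?_ (Finset.sum_nonneg fun i _ => hs i)
    rw [Finset.sum_range_succ]
    refine add_le_add (Finset.sum_le_sum fun i hi => ?_) (by simp)
    have : (i : ℝ) < n := by exact_mod_cast Finset.mem_range.1 hi
    exact div_le_div_of_nonneg_left (hs i) (by linarith) (by linarith)

theorem step_mul_bias_le {γ a lam lam0 τ p : ℝ} (hγ : 0 ≤ γ) (ha : 0 ≤ a) (hlam0 : 0 < lam0)
    (hτ : 0 < τ) (hp : 1 ≤ p) (hlam : lam0 * τ ≤ lam) :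
    γ / τ * (a * lam ^ (1 - p)) ≤ γ * (a / lam0 ^ (p - 1)) * (1 / τ ^ p) := by
  have hpow : lam ^ (1 - p) ≤ lam0 ^ (1 - p) * τ ^ (1 - p) := by
    rw [← mul_rpow hlam0.le hτ.le]
    exact rpow_le_rpow_of_nonpos (by positivity) hlam (by linarith)
  calc γ / τ * (a * lam ^ (1 - p)) ≤ γ / τ * (a * (lam0 ^ (1 - p) * τ ^ (1 - p))) := by gcongr
    _ = _ := by
      rw [← neg_sub p 1, rpow_neg hlam0.le, rpow_neg hτ.le, rpow_sub_one hτ.ne' p]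
      have := rpow_pos_of_pos hτ p
      have := rpow_pos_of_pos hlam0 (p - 1)
      field_simp

theorem sq_step_mul_moment_le {γ b lam M τ p : ℝ} (hb : 0 ≤ b) (hlam0 : 0 ≤ lam)
    (hM : 0 ≤ M) (hτ : 0 < τ) (hp : p ≤ 2) (hlam : lam ≤ M * τ) :
    (γ / τ) ^ 2 * (b * lam ^ (2 - p)) ≤ γ ^ 2 * (b * M ^ (2 - p)) * (1 / τ ^ p) := by
  have hpow : lam ^ (2 - p) ≤ M ^ (2 - p) * τ ^ (2 - p) := by
    rw [← mul_rpow hM hτ.le]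
    exact rpow_le_rpow hlam0 hlam (by linarith)
  calc (γ / τ) ^ 2 * (b * lam ^ (2 - p))
      ≤ (γ / τ) ^ 2 * (b * (M ^ (2 - p) * τ ^ (2 - p))) := by gcongr
    _ = _ := by
      rw [rpow_sub hτ, rpow_two]
      have := rpow_pos_of_pos hτ p
      field_simp

theorem clipped_ssgm_last_iterate_anytime
    {H : Type*} [NormedAddCommGroup H] [InnerProductSpace ℝ H]
    [CompleteSpace H] [SecondCountableTopology H]
    {Ω : Type*} [mΩ : MeasurableSpace Ω] (μ : Measure Ω) [IsProbabilityMeasure μ]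
    (X : Set H) (hXne : X.Nonempty) (hXcl : IsClosed X) (hXcv : Convex ℝ X)
    (f : H → ℝ) (hfcv : ConvexOn ℝ Set.univ f)
    (L : ℝ) (hL : 0 < L) (hfLip : LipschitzWith L.toNNReal f)
    (xstar : H) (hxs : xstar ∈ X) (hxsmin : ∀ y ∈ X, f xstar ≤ f y)
    (p ε σm : ℝ) (hp1 : 1 < p) (hp2 : p ≤ 2) (hε : 0 < ε) (hσm : 0 ≤ σm)
    (Lε ap bp : ℝ)
    (hLε : Lε = (1 + ε) * L)
    (hap : ap = (1 + 1 / ε) ^ (p - 1) * σm ^ p)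
    (hbp : bp = (2 : ℝ) ^ (p - 1) * (σm ^ p + L ^ p))
    (ℱ : ℕ → MeasurableSpace Ω) (hℱ : ∀ k, ℱ k ≤ mΩ) (hℱmono : Monotone ℱ)
    (γ lam : ℕ → ℝ)
    (hγpos : ∀ k, 1 ≤ k → 0 < γ k)
    (hlamLε : ∀ k, 1 ≤ k → Lε ≤ lam k)
    (x u ut : ℕ → Ω → H)
    (x1 : H) (hx1 : ∀ ω, x 1 ω = x1) (hx1X : x1 ∈ X)
    (hxmeas : ∀ k, 1 ≤ k → StronglyMeasurable[ℱ k] (x k))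
    (hxX : ∀ k, 1 ≤ k → ∀ ω, x k ω ∈ X)
    (hxint : ∀ k, 1 ≤ k → Integrable (fun ω => ‖x k ω‖ ^ 2) μ)
    (humeas : ∀ k, 1 ≤ k → StronglyMeasurable[ℱ k] (u k))
    (husub : ∀ k, 1 ≤ k → ∀ᵐ ω ∂μ, ∀ y : H,
      f (x k ω) + ⟪u k ω, y - x k ω⟫ ≤ f y)
    (hutmeas : ∀ k, 1 ≤ k → StronglyMeasurable[ℱ (k + 1)] (ut k))
    (hutbdd : ∀ k, 1 ≤ k → ∀ᵐ ω ∂μ, ‖ut k ω‖ ≤ lam k)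
    (hbias : ∀ k, 1 ≤ k →
      ∀ᵐ ω ∂μ, ‖(μ[ut k | ℱ k]) ω - u k ω‖ ≤ ap * lam k ^ (1 - p))
    (hmom : ∀ k, 1 ≤ k →
      ∀ᵐ ω ∂μ, (μ[(fun ω' => ‖ut k ω'‖ ^ 2) | ℱ k]) ω ≤ bp * lam k ^ (2 - p))
    (hproj : ∀ k, 1 ≤ k → ∀ ω, x (k + 1) ω ∈ X ∧
      ∀ y ∈ X, ‖x (k + 1) ω - (x k ω - γ k • ut k ω)‖ ≤ ‖y - (x k ω - γ k • ut k ω)‖)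
    (γ0 lam0 : ℝ) (hγ0 : 0 < γ0) (hlam0 : 0 < lam0)
    (hγsched : ∀ k : ℕ, 1 ≤ k →
      γ k = γ0 / ((k : ℝ) * (1 + Real.log k)) ^ (1 / p))
    (hlamsched : ∀ k : ℕ, 1 ≤ k →
      lam k = max Lε (lam0 * ((k : ℝ) * (1 + Real.log k)) ^ (1 / p)))
    (vp wp : ℝ) (hvp : vp = 4 * ap / lam0 ^ (p - 1))
    (hwp : wp = bp * (max Lε lam0) ^ (2 - p)) :
    ∀ k : ℕ, 1 ≤ k →
      (∫ ω, f (x k ω) ∂μ) - f xstar ≤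
        ((1 + Real.log k) ^ (1 / p) / (k : ℝ) ^ ((p - 1) / p)) *
          ((5 / 9) * ‖x1 - xstar‖ ^ 2 / γ0 + (6 / 5) * vp * ‖x1 - xstar‖ +
            (3 / 4) * γ0 * (1 + Real.log (1 + Real.log k)) ^ 2 *
              (vp + Real.sqrt wp) ^ 2) := by
  intro k hk
  obtain ⟨n, rfl⟩ : ∃ n, k = n + 1 := ⟨k - 1, by omega⟩
  have hp0 : 0 < p := by linarith
  have hap0 : 0 ≤ ap := by rw [hap]; positivity
  have hbp0 : 0 ≤ bp := by rw [hbp]; positivity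
  have hLε0 : 0 < Lε := by rw [hLε]; positivity
  have hvp0 : 0 ≤ vp := by rw [hvp]; positivity
  have hM0 : 0 < max Lε lam0 := lt_max_of_lt_left hLε0
  have hwp0 : 0 ≤ wp := by rw [hwp]; positivity
  have hlog : ∀ i : ℕ, 0 ≤ log ((i : ℝ) + 1) := fun i =>
    log_nonneg (by linarith [i.cast_nonneg (α := ℝ)])
  set t : ℕ → ℝ := fun i => ((i : ℝ) + 1) * (1 + log ((i : ℝ) + 1)) with ht
  have ht1 : ∀ i, 1 ≤ t i := fun i =>
    one_le_mul_of_one_le_of_one_le (by linarith [i.cast_nonneg (α := ℝ)]) (by linarith [hlog i])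
  have htmono : Monotone t := by
    intro i j hij
    have hij' : (i : ℝ) ≤ j := by exact_mod_cast hij
    have hi0 : (0 : ℝ) ≤ i := i.cast_nonneg
    have hl := hlog i
    have hl' : log ((i : ℝ) + 1) ≤ log ((j : ℝ) + 1) := log_le_log (by linarith) (by linarith)
    exact mul_le_mul (by linarith) (by linarith) (by linarith) (by linarith)
  set τ : ℕ → ℝ := fun i => t i ^ (1 / p) with hτ
  have hτ1 : ∀ i, 1 ≤ τ i := fun i => one_le_rpow (ht1 i) (by positivity)
  have hτpos : ∀ i, 0 < τ i := fun i => one_pos.trans_le (hτ1 i)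
  have hτp : ∀ i, τ i ^ p = t i := fun i => by
    simp only [hτ]
    rw [← rpow_mul (by linarith [ht1 i]), one_div_mul_cancel hp0.ne', rpow_one]
  have hγ' : ∀ i, γ (i + 1) = γ0 / τ i := fun i => by
    rw [hγsched (i + 1) (by omega)]
    simp only [hτ, ht]
    push_cast
    rfl
  have hlam' : ∀ i, lam (i + 1) = max Lε (lam0 * τ i) := fun i => by
    rw [hlamsched (i + 1) (by omega)]
    simp only [hτ, ht]
    push_cast
    rfl
  have hlamle : ∀ i, lam (i + 1) ≤ max Lε lam0 * τ i := fun i => by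
    rw [hlam', max_mul_of_nonneg _ _ (hτpos i).le]
    exact max_le_max (le_mul_of_one_le_right hLε0.le (hτ1 i)) le_rfl
  have hlampos : ∀ i, 0 < lam (i + 1) := fun i => hLε0.trans_le (hlamLε _ (by omega))
  have hbiasw : ∀ i, γ (i + 1) * (ap * lam (i + 1) ^ (1 - p)) ≤ γ0 * (vp / 4) * (1 / t i) := by
    intro i
    have h := step_mul_bias_le hγ0.le hap0 hlam0 (hτpos i) hp1.le
      ((le_max_right Lε _).trans_eq (hlam' i).symm)
    rw [hτp, ← hγ'] at h
    refine h.trans_eq ?_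
    rw [hvp]
    ring
  have hmomw : ∀ i, γ (i + 1) ^ 2 * (bp * lam (i + 1) ^ (2 - p)) ≤ γ0 ^ 2 * wp * (1 / t i) := by
    intro i
    have h := sq_step_mul_moment_le (γ := γ0) hbp0 (hlampos i).le hM0.le (hτpos i) hp2 (hlamle i)
    rwa [hτp, ← hγ', ← hwp] at h
  have hxL : ∀ i, MemLp (x (i + 1)) 2 μ := fun i =>
    (memLp_two_iff_integrable_sq_norm
      ((hxmeas _ (by omega)).mono (hℱ _)).aestronglyMeasurable).2 (hxint _ (by omega))
  have hγanti : Antitone fun i => γ (i + 1) := by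
    intro i j hij
    simp only [hγ']
    have : τ i ≤ τ j := rpow_le_rpow (by linarith [ht1 i]) (htmono hij) (by positivity)
    exact div_le_div_of_nonneg_left hγ0.le (hτpos i) this
  have hs0 : ∀ i, 0 ≤ 1 / t i := fun i => one_div_nonneg.2 (by linarith [ht1 i])
  have hlast := last_iterate_le (μ := μ) (ℱ := fun i => ℱ (i + 1)) (x := fun i => x (i + 1))
    (γ := fun i => γ (i + 1)) (b := fun i => γ0 * (vp / 4) * (1 / t i))
    (c := fun i => γ0 ^ 2 * wp * (1 / t i)) hXcv hfcv hfLip hxs hxsmin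
    (fun i j hij => hℱmono (by omega)) (fun i => hxmeas _ (by omega))
    (fun i => hxX _ (by omega)) hxL (fun i => (hγpos _ (by omega)).le) hγanti
    (fun i => mul_nonneg (by positivity) (hs0 i)) (fun i => mul_nonneg (by positivity) (hs0 i))
    (by
      intro i y hym hyL hyX
      have hi : 1 ≤ i + 1 := by omega
      have h := integral_norm_sq_projected_step_le (hℱ (i + 1)) hfLip (hγpos _ hi).le
        (mul_nonneg hap0 (rpow_nonneg (hlampos i).le (1 - p))) (hxmeas _ hi) hym (hxL i) hyL
        (hxL (i + 1)) ((hutmeas _ hi).mono (hℱ _)).aestronglyMeasurable (hutbdd _ hi)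
        ((husub _ hi).mono fun ω hω => hω (y ω)) (hbias _ hi) (hmom _ hi)
        (fun ω => norm_nearest_sub_le hXcv (hproj _ hi ω).1 (hyX ω) (hproj _ hi ω).2)
      have hb := mul_le_mul_of_nonneg_right (hbiasw i)
        (Real.sqrt_nonneg (∫ ω, ‖x (i + 1) ω - y ω‖ ^ 2 ∂μ))
      linarith [hmomw i]) n
  have hD : ∫ ω, ‖x (0 + 1) ω - xstar‖ ^ 2 ∂μ = ‖x1 - xstar‖ ^ 2 := by simp [hx1]
  simp only [hD] at hlast
  set Q := ∑ i ∈ Finset.range n, 1 / t i / ((n : ℝ) - i) + 1 / t n with hQ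
  set B := ∑ i ∈ Finset.range (n + 1), 1 / t i / √((n : ℝ) - i + 1) with hB
  set S := 1 + log (1 + log ((n : ℝ) + 1)) with hS
  have hQ0 : 0 ≤ Q := add_nonneg (Finset.sum_nonneg fun i hi => div_nonneg (hs0 i) (by
    have : (i : ℝ) < n := by exact_mod_cast Finset.mem_range.1 hi
    linarith)) (hs0 n)
  have hB0 : 0 ≤ B := Finset.sum_nonneg fun i _ => div_nonneg (hs0 i) (Real.sqrt_nonneg _)
  have hS0 : 0 ≤ S := add_nonneg zero_le_one (log_nonneg (by linarith [hlog n]))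
  have hsumc : ‖x1 - xstar‖ ^ 2 / ((n : ℝ) + 1)
      + ∑ i ∈ Finset.range n, γ0 ^ 2 * wp * (1 / t i) / ((n : ℝ) - i) + γ0 ^ 2 * wp * (1 / t n)
      = (‖x1 - xstar‖ ^ 2 + γ0 ^ 2 * wp * (((n : ℝ) + 1) * Q)) / ((n : ℝ) + 1) := by
    simp_rw [mul_div_assoc (γ0 ^ 2 * wp), ← Finset.mul_sum]
    rw [add_assoc, ← mul_add, ← hQ]
    field_simp
  have hsumb : ∑ i ∈ Finset.range (n + 1), γ0 * (vp / 4) * (1 / t i) / √((n : ℝ) - i + 1)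
      = γ0 * (vp / 4) * (√((n : ℝ) + 1) * B) / √((n : ℝ) + 1) := by
    simp_rw [mul_div_assoc (γ0 * (vp / 4)), ← Finset.mul_sum]
    rw [← hB]
    field_simp
  have hn0 : (0 : ℝ) ≤ (n : ℝ) + 1 := by positivity
  rw [hsumc, hsumb, Real.sqrt_div' _ hn0, ← add_div, div_pow, Real.sq_sqrt hn0,
    le_div_iff₀ (by positivity)] at hlast
  have hsched := le_min_iff.1 (sum_weighted_schedule_le_log n)
  have hkm : (√((n : ℝ) + 1) * B) ^ 2 ≤ S * (((n : ℝ) + 1) * Q) := by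
    rw [mul_pow, Real.sq_sqrt hn0, mul_left_comm]
    refine mul_le_mul_of_nonneg_left ((sq_sum_schedule_le hs0 n).trans ?_) hn0
    exact mul_le_mul_of_nonneg_right (sum_inv_mul_one_add_log_le n) hQ0
  have hfinal := half_sq_le_anytime_bound (norm_nonneg (x1 - xstar)) hγ0.le hvp0 hwp0
    (mul_nonneg hn0 hQ0) (mul_nonneg (Real.sqrt_nonneg _) hB0) hS0 hsched.1 hsched.2 hkm
  push_cast
  rw [← hS]
  have hrate : (1 + log ((n : ℝ) + 1)) ^ (1 / p) / ((n : ℝ) + 1) ^ ((p - 1) / p)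
      = τ n / ((n : ℝ) + 1) := by
    have hn1 : (0 : ℝ) < (n : ℝ) + 1 := by positivity
    simp only [hτ, ht]
    rw [mul_rpow hn0 (by linarith [hlog n]), sub_div, div_self hp0.ne', rpow_sub hn1, rpow_one]
    have := rpow_pos_of_pos hn1 (1 / p)
    field_simp
  rw [hrate, div_mul_eq_mul_div, le_div_iff₀ (by positivity)]
  rw [hγ'] at hlast
  have hτn := hτpos n
  have hscaled : (∫ ω, f (x (n + 1) ω) ∂μ - f xstar) * ((n : ℝ) + 1)
      = τ n / γ0 * ((2 * (γ0 / τ n) * (∫ ω, f (x (n + 1) ω) ∂μ - f xstar) * ((n : ℝ) + 1)) / 2) := by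
    field_simp
  rw [hscaled]
  refine (mul_le_mul_of_nonneg_left
    ((div_le_div_of_nonneg_right hlast two_pos.le).trans hfinal) (by positivity)).trans_eq ?_
  field_simp
end

section
/- Let H be a real Hilbert space, X ⊆ H a nonempty closed convex set, f : H → ℝ a convex function, x_k ∈ X, u ∈ H a subgradient of f at x_k (i.e., f(y) ≥ f(x_k) + ⟨u, y − x_k⟩ for all y ∈ H), ũ ∈ H, and γ > 0. Let x_{k+1} ∈ X be a nearest point of X to x_k − γũ, i.e., ‖x_{k+1} − (x_k − γũ)‖ ≤ ‖y − (x_k − γũ)‖ for every y ∈ X. Then for every x ∈ X: γ(f(x_k) − f(x)) ≤ (‖x_k − x‖² − ‖x_{k+1} − x‖²)/2 + γ⟨ũ − u, x − x_k⟩ + (γ²/2)‖ũ‖². -/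
open scoped RealInnerProductSpace

/-- A nearest point `q` of a convex set to `p` is at least as close as `p` to every point
of the set. -/
theorem norm_sub_le_of_nearest_point
    {H : Type*} [NormedAddCommGroup H] [InnerProductSpace ℝ H]
    {X : Set H} (hX : Convex ℝ X) {p q : H} (hq : q ∈ X)
    (hmin : ∀ y ∈ X, ‖q - p‖ ≤ ‖y - p‖) {x : H} (hx : x ∈ X) :
    ‖q - x‖ ≤ ‖p - x‖ := by
  have : Nonempty X := ⟨⟨q, hq⟩⟩
  have hinf : ‖p - q‖ = ⨅ w : X, ‖p - w‖ := by
    refine le_antisymm (le_ciInf fun w => ?_) ?_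
    · simpa only [norm_sub_rev p] using hmin w w.2
    · exact ciInf_le ⟨0, by rintro _ ⟨w, rfl⟩; exact norm_nonneg _⟩ (⟨q, hq⟩ : X)
  have hinner := (norm_eq_iInf_iff_real_inner_le_zero hX hq).1 hinf x hx
  have hexp := norm_sub_sq_real (p - q) (x - q)
  rw [sub_sub_sub_cancel_right, norm_sub_rev x q] at hexp
  exact (sq_le_sq₀ (norm_nonneg _) (norm_nonneg _)).1 (by linarith [sq_nonneg ‖p - q‖])

theorem standard_inequality
    {H : Type*} [NormedAddCommGroup H] [InnerProductSpace ℝ H] [CompleteSpace H]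
    (X : Set H) (hXne : X.Nonempty) (hXcl : IsClosed X) (hXcv : Convex ℝ X)
    (f : H → ℝ) (hfcv : ConvexOn ℝ Set.univ f)
    (xk : H) (hxk : xk ∈ X)
    (u : H) (hu : ∀ y : H, f xk + ⟪u, y - xk⟫ ≤ f y)
    (ut : H) (γ : ℝ) (hγ : 0 < γ)
    (xk1 : H) (hxk1 : xk1 ∈ X)
    (hproj : ∀ y ∈ X, ‖xk1 - (xk - γ • ut)‖ ≤ ‖y - (xk - γ • ut)‖) :
    ∀ x ∈ X,
      γ * (f xk - f x) ≤
        (‖xk - x‖ ^ 2 - ‖xk1 - x‖ ^ 2) / 2 + γ * ⟪ut - u, x - xk⟫ +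
          (γ ^ 2 / 2) * ‖ut‖ ^ 2 := by
  intro x hx
  have hdist : ‖xk1 - x‖ ^ 2 ≤ ‖xk - γ • ut - x‖ ^ 2 := by
    gcongr
    exact norm_sub_le_of_nearest_point hXcv hxk1 hproj hx
  have hexp : ‖xk - γ • ut - x‖ ^ 2 =
      ‖xk - x‖ ^ 2 + 2 * (γ * ⟪ut, x - xk⟫) + γ ^ 2 * ‖ut‖ ^ 2 := by
    rw [sub_right_comm, norm_sub_sq_real, inner_smul_right, real_inner_comm,
      ← neg_sub x xk, inner_neg_right, norm_neg, norm_smul, mul_pow, Real.norm_eq_abs, sq_abs]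
    ring
  have hsub : γ * (f xk + ⟪u, x - xk⟫) ≤ γ * f x := by
    gcongr
    exact hu x
  rw [inner_sub_left]
  linarith
end

section
/- Fix an integer k ≥ 2, set n = ⌈log₂ k⌉, and define k_j = k − ⌈k/2^j⌉ for j = 0, 1, …, n, together with k_{n+1} = k. Then for every j ∈ {0, 1, …, n−1}: 4(k_{j+2} − k_{j+1}) ≥ k_{j+1} − k_j. -/
theorem Nat.ceil_half (x : ℝ) : ⌈x / 2⌉₊ = (⌈x⌉₊ + 1) / 2 := by
  refine eq_of_forall_ge_iff fun c => ?_
  have h : ⌈x⌉₊ ≤ 2 * c ↔ x / 2 ≤ c := by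
    rw [Nat.ceil_le, div_le_iff₀ two_pos]
    push_cast
    rw [mul_comm]
  rw [Nat.ceil_le, ← h]
  omega

theorem Nat.ceil_div_two_pow_succ (k j : ℕ) :
    ⌈(k : ℝ) / 2 ^ (j + 1)⌉₊ = (⌈(k : ℝ) / 2 ^ j⌉₊ + 1) / 2 := by
  rw [pow_succ, ← div_div, Nat.ceil_half]

theorem epoch_length_bound
    (k : ℕ) (hk : 2 ≤ k)
    (n : ℕ) (hn : n = Nat.clog 2 k)
    (kk : ℕ → ℕ)
    (hkk : ∀ j ≤ n, kk j = k - Nat.ceil ((k : ℝ) / 2 ^ j))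
    (hkktop : kk (n + 1) = k) :
    ∀ j : ℕ, j < n →
      ((kk (j + 1) : ℤ) - kk j) ≤ 4 * ((kk (j + 2) : ℤ) - kk (j + 1)) := by
  intro j hj
  have hle (i : ℕ) : ⌈(k : ℝ) / 2 ^ i⌉₊ ≤ k :=
    Nat.ceil_le.2 (div_le_self (Nat.cast_nonneg k) (one_le_pow₀ one_le_two))
  have h0 := hkk j hj.le
  have h1 := hkk (j + 1) hj
  have hs := Nat.ceil_div_two_pow_succ k j
  have hl := hle j
  have hl1 := hle (j + 1)
  rcases (Nat.succ_le_of_lt hj).eq_or_lt with h | h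
  · have hpos : 0 < ⌈(k : ℝ) / 2 ^ (j + 1)⌉₊ := Nat.ceil_pos.2 (by positivity)
    have h2 : kk (j + 2) = k := by rw [← hkktop, ← h]
    omega
  · have h2 := hkk (j + 2) h
    have hs1 := Nat.ceil_div_two_pow_succ k (j + 1)
    have hl2 := hle (j + 2)
    have hlt : 2 ^ (j + 1) < k := (Nat.lt_clog_iff_pow_lt one_lt_two).1 (hn ▸ h)
    have hb : 1 < ⌈(k : ℝ) / 2 ^ (j + 1)⌉₊ := by
      rw [Nat.lt_ceil, Nat.cast_one, one_lt_div (by positivity)]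
      exact_mod_cast hlt
    rw [show j + 1 + 1 = j + 2 from rfl] at hs1
    omega
end
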